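/- arXiv:1509.07241 — 10 statements merged into one kernel-verified Lean document; each statement's English description precedes it below -/
import Mathlib

section
/- Let W ⊆ H be a subspace with e ∈ W such that W ∩ H₀ and H/(W + H₀) are finite-dimensional over k with dim(W ∩ H₀) − dim(H/(W + H₀)) = 1 − g. Then the following are equivalent: (a) H is the internal direct sum of W and L'; (b) W ∩ H₀ = k·e and W + L = H; (c) the natural map L/H₀ → H/(W + H₀), induced by the inclusion L ⊆ H, is an isomorphism. -/
/-- For a surjective linear map `f : V → U` vanishing on `p`, with `V ⧸ p` and `U` finite-dimensional,
the kernel of `f` is exactly `p` if and only if `U` and `V ⧸ p` have the same dimension. -/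
theorem ker_eq_iff_finrank_eq_of_surjective {k V U : Type*} [Field k] [AddCommGroup V] [Module k V]
    [AddCommGroup U] [Module k U] (f : V →ₗ[k] U) (p : Submodule k V)
    [FiniteDimensional k (V ⧸ p)] [FiniteDimensional k U]
    (hp : p ≤ LinearMap.ker f) (hf : Function.Surjective f) :
    LinearMap.ker f = p ↔ Module.finrank k (V ⧸ p) = Module.finrank k U := by
  constructor
  · rintro rfl
    exact (f.quotKerEquivOfSurjective hf).finrank_eq
  · intro h
    have hsurj : Function.Surjective (p.liftQ f hp) := by
      rw [← LinearMap.range_eq_top, Submodule.range_liftQ, LinearMap.range_eq_top.mpr hf]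
    have hinj := (LinearMap.injective_iff_surjective_of_finrank_eq_finrank h).mpr hsurj
    refine le_antisymm (fun x hx => ?_) hp
    rw [← Submodule.Quotient.mk_eq_zero]
    apply hinj
    simpa using hx

/-- The composite `L → V → V ⧸ N` is surjective exactly when `N` and `L` span `V`. -/
theorem surjective_mkQ_comp_subtype_iff {k V : Type*} [Field k] [AddCommGroup V] [Module k V]
    (N L : Submodule k V) :
    Function.Surjective (N.mkQ.comp L.subtype) ↔ N ⊔ L = ⊤ := by
  rw [← LinearMap.range_eq_top, LinearMap.range_comp, Submodule.range_subtype,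
    Submodule.map_mkQ_eq_top]

/-- Let `k` be a field, `H` a `k`-vector space, `H₀ ⊆ L ⊆ H` subspaces,
`e ∈ H₀` a nonzero vector, `L'` a subspace with `L = k·e ⊕ L'` (internally),
`g ≥ 1` with `dim(L/H₀) = g`. Let `W ⊆ H` be a subspace with `e ∈ W` such that
`W ∩ H₀` and `H/(W + H₀)` are finite-dimensional with
`dim(W ∩ H₀) − dim(H/(W + H₀)) = 1 − g`. Then the following are equivalent:
(a) `H = W ⊕ L'` (internally);
(b) `W ∩ H₀ = k·e` and `W + L = H`;
(c) the natural map `L/H₀ → H/(W + H₀)` is an isomorphism. -/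
theorem open_cell_characterization {k H : Type*} [Field k] [AddCommGroup H] [Module k H]
    (H₀ L L' : Submodule k H) (hH₀L : H₀ ≤ L) (e : H) (he₀ : e ∈ H₀) (hene : e ≠ 0)
    (hL'L : L' ≤ L) (hsup : Submodule.span k {e} ⊔ L' = L)
    (hinf : Submodule.span k {e} ⊓ L' = ⊥)
    (g : ℕ) (hg : 1 ≤ g)
    [FiniteDimensional k (L ⧸ H₀.comap L.subtype)]
    (hdimL : Module.finrank k (L ⧸ H₀.comap L.subtype) = g)
    (W : Submodule k H) (heW : e ∈ W)
    [FiniteDimensional k (W ⊓ H₀ : Submodule k H)]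
    [FiniteDimensional k (H ⧸ (W ⊔ H₀))]
    (hindex : (Module.finrank k (W ⊓ H₀ : Submodule k H) : ℤ) -
      Module.finrank k (H ⧸ (W ⊔ H₀)) = 1 - g) :
    letI q : L →ₗ[k] (H ⧸ (W ⊔ H₀)) := (W ⊔ H₀).mkQ.comp L.subtype
    (IsCompl W L' ↔ (W ⊓ H₀ = Submodule.span k {e} ∧ W ⊔ L = ⊤)) ∧
    ((W ⊓ H₀ = Submodule.span k {e} ∧ W ⊔ L = ⊤) ↔
      (Function.Surjective q ∧ LinearMap.ker q = H₀.comap L.subtype)) := by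
  set q : L →ₗ[k] (H ⧸ (W ⊔ H₀)) := (W ⊔ H₀).mkQ.comp L.subtype
  have he : Submodule.span k {e} ≤ W ⊓ H₀ := by
    simpa [Submodule.span_singleton_le_iff_mem] using And.intro heW he₀
  have heW' : Submodule.span k {e} ≤ W := he.trans inf_le_left
  have hsupL' : W ⊔ L' = W ⊔ L := by
    rw [← hsup, ← sup_assoc, sup_eq_left.mpr heW']
  have hker : H₀.comap L.subtype ≤ LinearMap.ker q := fun x hx => by
    simpa [q] using Submodule.mem_sup_right (S := W) hx
  have hsurj : Function.Surjective q ↔ W ⊔ L = ⊤ := by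
    rw [surjective_mkQ_comp_subtype_iff, sup_assoc, sup_eq_right.mpr hH₀L]
  have hspan : W ⊓ H₀ = Submodule.span k {e} ↔
      Module.finrank k (W ⊓ H₀ : Submodule k H) = 1 := by
    constructor
    · intro h
      rw [h, finrank_span_singleton hene]
    · intro h
      exact (Submodule.eq_of_le_of_finrank_eq he (by rw [h, finrank_span_singleton hene])).symm
  have hbc : (W ⊓ H₀ = Submodule.span k {e} ∧ W ⊔ L = ⊤) ↔
      (Function.Surjective q ∧ LinearMap.ker q = H₀.comap L.subtype) := by
    rw [and_comm, ← hsurj]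
    refine and_congr_right fun hq => ?_
    rw [hspan, ker_eq_iff_finrank_eq_of_surjective q _ hker hq]
    omega
  refine ⟨⟨fun h => ⟨le_antisymm ?_ he, ?_⟩, fun h => ⟨?_, ?_⟩⟩, hbc⟩
  · calc W ⊓ H₀ ≤ (Submodule.span k {e} ⊔ L') ⊓ W := by
          rw [hsup, inf_comm]
          exact inf_le_inf_right W hH₀L
      _ = Submodule.span k {e} ⊔ L' ⊓ W := sup_inf_assoc_of_le L' heW'
      _ = Submodule.span k {e} := by rw [inf_comm, h.inf_eq_bot, sup_bot_eq]
  · rw [← hsupL', h.sup_eq_top]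
  · rw [disjoint_iff, eq_bot_iff, ← hinf, ← h.1]
    rintro x ⟨hxW, hxL'⟩
    have hx : (⟨x, hL'L hxL'⟩ : L) ∈ LinearMap.ker q := by
      simpa [q] using Submodule.mem_sup_left (T := H₀) hxW
    rw [(hbc.mp h).2] at hx
    exact ⟨⟨hxW, hx⟩, hxL'⟩
  · rw [codisjoint_iff, hsupL', h.2]
end

section
/- Let k be a field, H a k-vector space, and W, A, B subspaces of H with A ⊆ B. Assume that B/A, W ∩ A, and H/(W + A) are finite-dimensional over k. Then W ∩ B and H/(W + B) are also finite-dimensional, and dim(W ∩ B) − dim(H/(W + B)) = dim(W ∩ A) − dim(H/(W + A)) + dim(B/A). -/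
/-- Let `k` be a field, `H` a `k`-vector space, and `W, A, B` subspaces
of `H` with `A ⊆ B`. Assume that `B/A`, `W ∩ A`, and `H/(W + A)` are finite-dimensional
over `k`. Then `W ∩ B` and `H/(W + B)` are also finite-dimensional, and
`dim(W ∩ B) − dim(H/(W + B)) = dim(W ∩ A) − dim(H/(W + A)) + dim(B/A)`. -/
theorem finrank_inf_sub_finrank_quot_eq {k H : Type*} [Field k] [AddCommGroup H]
    [Module k H] (W A B : Submodule k H) (hAB : A ≤ B)
    [FiniteDimensional k (B ⧸ A.comap B.subtype)]
    [FiniteDimensional k (W ⊓ A : Submodule k H)]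
    [FiniteDimensional k (H ⧸ (W ⊔ A))] :
    FiniteDimensional k (W ⊓ B : Submodule k H) ∧
    FiniteDimensional k (H ⧸ (W ⊔ B)) ∧
    (Module.finrank k (W ⊓ B : Submodule k H) : ℤ) -
        Module.finrank k (H ⧸ (W ⊔ B)) =
      (Module.finrank k (W ⊓ A : Submodule k H) : ℤ) -
        Module.finrank k (H ⧸ (W ⊔ A)) +
        Module.finrank k (B ⧸ A.comap B.subtype) := by
  let f : (W ⊓ B : Submodule k H) →ₗ[k] B ⧸ A.comap B.subtype :=
    (A.comap B.subtype).mkQ ∘ₗ Submodule.inclusion inf_le_right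
  let g : (B ⧸ A.comap B.subtype) →ₗ[k] H ⧸ (W ⊔ A) :=
    (A.comap B.subtype).mapQ (W ⊔ A) B.subtype (Submodule.comap_mono le_sup_right)
  let h : (H ⧸ (W ⊔ A)) →ₗ[k] H ⧸ (W ⊔ B) := Submodule.factor (sup_le_sup_left hAB W)
  have f_ker : LinearMap.ker f = (W ⊓ A).comap (W ⊓ B).subtype := by
    ext x
    have hx : (x : H) ∈ W := x.2.1
    simp [f, hx]
  have fg_exact : LinearMap.range f = LinearMap.ker g := by
    ext y
    obtain ⟨b, rfl⟩ := Submodule.mkQ_surjective _ y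
    constructor
    · rintro ⟨x, hx⟩
      rw [← hx]
      simpa [f, g] using Submodule.mem_sup_left x.2.1
    · intro hb
      obtain ⟨w, hw, a, ha, hwa⟩ := Submodule.mem_sup.1
        (show (b : H) ∈ W ⊔ A by simpa [g] using hb)
      have hwB : w ∈ B := by
        rw [eq_sub_of_add_eq hwa]
        exact B.sub_mem b.2 (hAB ha)
      refine ⟨⟨w, hw, hwB⟩, (Submodule.Quotient.eq _).2 ?_⟩
      have hwb : w - (b : H) = -a := by rw [← hwa]; abel
      change w - (b : H) ∈ A
      rw [hwb]
      exact A.neg_mem ha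
  have gh_exact : LinearMap.range g = LinearMap.ker h := by
    ext y
    obtain ⟨v, rfl⟩ := Submodule.mkQ_surjective _ y
    constructor
    · rintro ⟨z, hz⟩
      obtain ⟨b, rfl⟩ := Submodule.mkQ_surjective _ z
      rw [← hz]
      simpa [g, h] using Submodule.mem_sup_right b.2
    · intro hv
      obtain ⟨w, hw, b, hb, hwb⟩ := Submodule.mem_sup.1
        (show v ∈ W ⊔ B by simpa [h] using hv)
      refine ⟨Submodule.Quotient.mk ⟨b, hb⟩, (Submodule.Quotient.eq _).2 ?_⟩
      have hbv : b - v = -w := by rw [← hwb]; abel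
      change b - v ∈ W ⊔ A
      rw [hbv]
      exact Submodule.neg_mem _ (Submodule.mem_sup_left hw)
  have h_surj : Function.Surjective h := Submodule.factor_surjective _
  let e : LinearMap.ker f ≃ₗ[k] (W ⊓ A : Submodule k H) :=
    (LinearEquiv.ofEq _ _ f_ker).trans
      (Submodule.comapSubtypeEquivOfLe (inf_le_inf_left W hAB))
  have : FiniteDimensional k (LinearMap.ker f) := e.symm.finiteDimensional
  have : FiniteDimensional k (W ⊓ B : Submodule k H) :=
    have : FiniteDimensional k ((W ⊓ B : Submodule k H) ⧸ LinearMap.ker f) :=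
      f.quotKerEquivRange.symm.finiteDimensional
    Module.Finite.of_submodule_quotient (LinearMap.ker f)
  have : FiniteDimensional k (H ⧸ (W ⊔ B)) := Module.Finite.of_surjective h h_surj
  refine ⟨inferInstance, inferInstance, ?_⟩
  have f_rank := f.finrank_range_add_finrank_ker
  have g_rank := g.finrank_range_add_finrank_ker
  have h_rank := h.finrank_range_add_finrank_ker
  rw [e.finrank_eq, fg_exact] at f_rank
  rw [gh_exact] at g_rank
  rw [LinearMap.range_eq_top.2 h_surj, finrank_top] at h_rank
  omega
end

section
/- Fix an integer N ≥ 1 and let W ⊆ H be a k-subalgebra with 𝟙 ∈ W. Assume: (1) H = W + H_{≥(−N,…,−N)}; (2) there are elements g₁,…,g_r ∈ W such that 𝟙, g₁,…,g_r is a k-basis of W ∩ H_{≥(−N,…,−N)}; (3) for each i = 1,…,n and each j = 0,…,N there is an element h_i(j) ∈ W with h_i(j) ∈ H_{≥ −(N,…,N) − (1+j)e_i} and h_i(j) − t_i^{−N−1−j} ∈ H_{≥ −(N,…,N) − j·e_i} (i.e. h_i(j) has pole of order exactly N+1+j in t_i with leading coefficient 1, and poles of order at most N in the other variables). Set f_i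 := h_i(0). Then the family consisting of 𝟙, the elements g_k (1 ≤ k ≤ r), the powers f_i^m (1 ≤ i ≤ n, m ≥ 1), and the products f_i^m·h_i(j) (1 ≤ i ≤ n, m ≥ 0, 1 ≤ j ≤ N) is a k-basis of W; in particular the elements f_i, h_i(j), g_k generate W as a k-algebra. Moreover, for every integer m ≥ N, the subspace W ∩ H_{≥(−m,…,−m)} is spanned by 𝟙, the elements g_k, and those monomials f_i^p and f_i^p·h_i(j) whose pole order in t_i is at most m, i.e. f_i^p with p(N+1) ≤ m and f_i^p·h_i(j) with (p+1)(N+1)+j ≤ m. -/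
/-- `H_{≥b} ⊆ H = ∏_{i=1}^n k((t_i))`: the set of elements whose `i`-th
component lies in `t^{b_i}·k[[t]]` for every `i`. -/
def HgeSet (k : Type*) [Field k] (n : ℕ) (b : Fin n → ℤ) :
    Set (Fin n → LaurentSeries k) :=
  {x | ∀ i : Fin n, ∀ m : ℤ, m < b i → (x i).coeff m = 0}

/-- The element `t_i^m` of `H = ∏_{i=1}^n k((t_i))`. -/
noncomputable def tPow (k : Type*) [Field k] (n : ℕ) (i : Fin n) (m : ℤ) :
    Fin n → LaurentSeries k :=
  Pi.single i (HahnSeries.single m (1 : k))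

/-- `H_{≥b}` as a `k`-subspace of `H`. -/
def HgeSubmodule (k : Type*) [Field k] (n : ℕ) (b : Fin n → ℤ) :
    Submodule k (Fin n → LaurentSeries k) where
  carrier := HgeSet k n b
  zero_mem' := fun i m _ => by simp
  add_mem' := fun {x y} hx hy i m hm => by
    simp [HahnSeries.coeff_add, hx i m hm, hy i m hm]
  smul_mem' := fun c x hx i m hm => by
    simp [HahnSeries.coeff_smul, hx i m hm]

theorem C_mem_subalgebra {k : Type*} [Field k] {n : ℕ}
    (W : Subalgebra k (Fin n → LaurentSeries k)) (c : k) :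
    (fun _ => HahnSeries.C c : Fin n → LaurentSeries k) ∈ W := by
  convert W.algebraMap_mem c using 1
  funext i
  rw [Pi.algebraMap_apply, HahnSeries.algebraMap_apply', PowerSeries.algebraMap_apply]
  simp

/-- A subalgebra of `H`, as a subspace for the coefficientwise scalar action. This action agrees
only propositionally with the one coming from the algebra structure used by `Subalgebra`, so
`Subalgebra.toSubmodule` does not apply. -/
def Subalgebra.toPiSubmodule {k : Type*} [Field k] {n : ℕ}
    (W : Subalgebra k (Fin n → LaurentSeries k)) : Submodule k (Fin n → LaurentSeries k) where
  carrier := W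
  zero_mem' := zero_mem W
  add_mem' := add_mem
  smul_mem' c x hx := by
    have hcx : c • x = (fun _ => HahnSeries.C c) * x :=
      funext fun i => HahnSeries.C_mul_eq_smul.symm
    rw [hcx]
    exact mul_mem (C_mem_subalgebra W c) hx

theorem Subalgebra.mem_toPiSubmodule {k : Type*} [Field k] {n : ℕ}
    {W : Subalgebra k (Fin n → LaurentSeries k)} {x : Fin n → LaurentSeries k} :
    x ∈ W.toPiSubmodule ↔ x ∈ W :=
  Iff.rfl

theorem HgeSet_anti {k : Type*} [Field k] {n : ℕ} {b c : Fin n → ℤ} (hbc : b ≤ c) :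
    HgeSet k n c ⊆ HgeSet k n b :=
  fun _ hx i m hm => hx i m (hm.trans_le (hbc i))

/-- The linear functional taking the coefficient of `t_i^m`. -/
def piCoeff (k : Type*) [Field k] (n : ℕ) (i : Fin n) (m : ℤ) :
    (Fin n → LaurentSeries k) →ₗ[k] k where
  toFun x := (x i).coeff m
  map_add' x y := by simp
  map_smul' c x := by simp

@[simp]
theorem piCoeff_apply {k : Type*} [Field k] {n : ℕ} (i : Fin n) (m : ℤ)
    (x : Fin n → LaurentSeries k) : piCoeff k n i m x = (x i).coeff m :=
  rfl

/-- Every element of `H` has poles of bounded order. -/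
theorem exists_mem_HgeSet {k : Type*} [Field k] {n : ℕ} (x : Fin n → LaurentSeries k)
    (N : ℕ) : ∃ m : ℕ, N ≤ m ∧ x ∈ HgeSet k n (fun _ => -(m : ℤ)) := by
  refine ⟨N + ∑ i, (x i).order.natAbs, Nat.le_add_right _ _, fun i m hm => ?_⟩
  apply HahnSeries.coeff_eq_zero_of_lt_order
  have hi : (x i).order.natAbs ≤ ∑ i, (x i).order.natAbs :=
    Finset.single_le_sum (f := fun i => (x i).order.natAbs) (fun _ _ => Nat.zero_le _)
      (Finset.mem_univ i)
  simp only [Nat.cast_add] at hm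
  omega

theorem LaurentSeries.coeff_mul_of_lt {k : Type*} [Field k] {x y : LaurentSeries k} {a b : ℤ}
    (hx : ∀ m < a, x.coeff m = 0) (hy : ∀ m < b, y.coeff m = 0) {c : ℤ} (hc : c < a + b) :
    (x * y).coeff c = 0 := by
  rw [HahnSeries.coeff_mul]
  refine Finset.sum_eq_zero fun p hp => ?_
  have hp' := (Finset.mem_antidiagonal.1 hp).2.2
  by_cases h : p.1 < a
  · rw [hx _ h, zero_mul]
  · rw [hy _ (by omega), mul_zero]

theorem LaurentSeries.coeff_mul_add {k : Type*} [Field k] {x y : LaurentSeries k} {a b : ℤ}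
    (hx : ∀ m < a, x.coeff m = 0) (hy : ∀ m < b, y.coeff m = 0) :
    (x * y).coeff (a + b) = x.coeff a * y.coeff b := by
  rw [HahnSeries.coeff_mul]
  refine Finset.sum_eq_single (a, b) (fun p hp hne => ?_) fun hab => ?_
  · have hp' := (Finset.mem_antidiagonal.1 hp).2.2
    by_cases h : p.1 < a
    · rw [hx _ h, zero_mul]
    · by_cases h' : p.1 = a
      · exact absurd (Prod.ext h' (by simp only; omega)) hne
      · rw [hy _ (by omega), mul_zero]
  · by_contra hne
    exact hab (Finset.mem_antidiagonal.2
      ⟨left_ne_zero_of_mul hne, right_ne_zero_of_mul hne, rfl⟩)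

/-- `x` has leading term `t_i^{-q}`: a pole of order `q` with leading coefficient `1` in `t_i`,
and poles of order less than `q` in the other variables. -/
structure HasLead {k : Type*} [Field k] {n : ℕ} (i : Fin n) (q : ℕ)
    (x : Fin n → LaurentSeries k) : Prop where
  coeff_self : (x i).coeff (-(q : ℤ)) = 1
  coeff_of_lt : ∀ m < -(q : ℤ), (x i).coeff m = 0
  coeff_of_ne : ∀ i' ≠ i, ∀ m < -(q : ℤ) + 1, (x i').coeff m = 0

namespace HasLead

variable {k : Type*} [Field k] {n : ℕ} {i : Fin n} {q q' : ℕ} {x y : Fin n → LaurentSeries k}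

theorem mul (hx : HasLead i q x) (hy : HasLead i q' y) : HasLead i (q + q') (x * y) where
  coeff_self := by
    have h := LaurentSeries.coeff_mul_add hx.coeff_of_lt hy.coeff_of_lt
    rw [hx.coeff_self, hy.coeff_self, mul_one] at h
    rw [← h, Pi.mul_apply]
    congr 1
    push_cast
    ring
  coeff_of_lt m hm :=
    LaurentSeries.coeff_mul_of_lt hx.coeff_of_lt hy.coeff_of_lt (by push_cast at hm; omega)
  coeff_of_ne i' hi' m hm :=
    LaurentSeries.coeff_mul_of_lt (hx.coeff_of_ne i' hi') (hy.coeff_of_ne i' hi')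
      (by push_cast at hm; omega)

theorem pow_mul (hx : HasLead i q x) (hy : HasLead i q' y) (p : ℕ) :
    HasLead i (p * q + q') (x ^ p * y) := by
  induction p with
  | zero => simpa using hy
  | succ p ih =>
    have h := hx.mul ih
    rwa [← mul_assoc, ← pow_succ', ← add_assoc, add_comm q, ← Nat.succ_mul] at h

theorem mem_HgeSet (hx : HasLead i q x) : x ∈ HgeSet k n (fun _ => -(q : ℤ)) := by
  intro i' m hm
  by_cases hi : i' = i
  · subst hi
    exact hx.coeff_of_lt m hm
  · exact hx.coeff_of_ne i' hi m (by simp only at hm; omega)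

/-- The leading terms separate elements of pole order at most `q`. -/
theorem coeff_eq_zero {i₀ : Fin n} {q₀ : ℕ} (hx : HasLead i q x) (hq : q ≤ q₀)
    (hne : (i, q) ≠ (i₀, q₀)) : (x i₀).coeff (-(q₀ : ℤ)) = 0 := by
  by_cases hi : i₀ = i
  · subst hi
    have : q ≠ q₀ := fun h => hne (by rw [h])
    exact hx.coeff_of_lt _ (by omega)
  · exact hx.coeff_of_ne _ hi _ (by omega)

end HasLead

/-- An independent family stays independent after adjoining a family which is unitriangular with
respect to functionals vanishing on the first family. -/
theorem LinearIndependent.sumElim_of_triangular {K V α β : Type*} [Field K] [AddCommGroup V]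
    [Module K V] {u : α → V} (hu : LinearIndependent K u) (v : β → V) (φ : β → V →ₗ[K] K)
    (d : β → ℕ) (hφu : ∀ b a, φ b (u a) = 0) (hφv : ∀ b, φ b (v b) = 1)
    (hφ : ∀ b b', d b' ≤ d b → b' ≠ b → φ b (v b') = 0) :
    LinearIndependent K (Sum.elim u v) := by
  have key : ∀ (s : Finset β) (c : β → K) (w : V), w ∈ Submodule.span K (Set.range u) →
      w + ∑ b ∈ s, c b • v b = 0 → ∀ b ∈ s, c b = 0 := by
    classical
    intro s c w hw hsum
    by_contra! hcon
    obtain ⟨b₀, hb₀, hcb₀⟩ := hcon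
    obtain ⟨b, hb, hmax⟩ := (s.filter fun b => c b ≠ 0).exists_max_image d
      ⟨b₀, Finset.mem_filter.2 ⟨hb₀, hcb₀⟩⟩
    rw [Finset.mem_filter] at hb
    have hφw : φ b w = 0 := by
      have : Submodule.span K (Set.range u) ≤ LinearMap.ker (φ b) := by
        rw [Submodule.span_le]
        rintro _ ⟨a, rfl⟩
        exact hφu b a
      exact this hw
    have h := congrArg (φ b) hsum
    rw [map_add, hφw, zero_add, map_sum, map_zero, Finset.sum_eq_single_of_mem b hb.1] at h
    · rw [map_smul, hφv, smul_eq_mul, mul_one] at h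
      exact hb.2 h
    · intro b' hb' hne
      by_cases hc : c b' = 0
      · rw [hc, zero_smul, map_zero]
      · rw [map_smul, hφ b b' (hmax b' (Finset.mem_filter.2 ⟨hb', hc⟩)) hne, smul_zero]
  refine LinearIndependent.sum_type hu ?_ ?_
  · rw [linearIndependent_iff']
    intro s c hc
    exact key s c 0 (zero_mem _) (by rw [zero_add, hc])
  · rw [Submodule.disjoint_def]
    intro w hw hwv
    obtain ⟨c, rfl⟩ := (Finsupp.mem_span_range_iff_exists_finsupp).1 hwv
    have h0 := key c.support (fun b => -c b) _ hw (by simp [Finsupp.sum])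
    exact Finset.sum_eq_zero fun b hb => by simp only [neg_eq_zero.1 (h0 b hb), zero_smul]

/-- If `W` contains, for every `i` and every `q > N`, an element with leading term `t_i^{-q}`, then
these elements for `q ≤ m` span `W ∩ H_{≥-m}` modulo `W ∩ H_{≥-N}`. -/
theorem le_of_forall_hasLead {k : Type*} [Field k] {n N : ℕ}
    (W : Submodule k (Fin n → LaurentSeries k)) (e : Fin n → ℕ → (Fin n → LaurentSeries k))
    (heW : ∀ i q, N < q → e i q ∈ W) (he : ∀ i q, N < q → HasLead i q (e i q))
    (m : ℕ) (hm : N ≤ m) (S : Submodule k (Fin n → LaurentSeries k))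
    (hNS : W ⊓ HgeSubmodule k n (fun _ => -(N : ℤ)) ≤ S)
    (heS : ∀ i q, N < q → q ≤ m → e i q ∈ S) :
    W ⊓ HgeSubmodule k n (fun _ => -(m : ℤ)) ≤ S := by
  induction m, hm using Nat.le_induction with
  | base => exact hNS
  | succ m hm ih =>
    rintro x ⟨hxW, hx⟩
    have hlt : N < m + 1 := Nat.lt_succ_of_le hm
    set y := ∑ i, (x i).coeff (-((m + 1 : ℕ) : ℤ)) • e i (m + 1) with hy
    have hyW : y ∈ W := sum_mem fun i _ => W.smul_mem _ (heW i _ hlt)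
    have hyS : y ∈ S := sum_mem fun i _ => S.smul_mem _ (heS i _ hlt le_rfl)
    have hyH : y ∈ HgeSubmodule k n (fun _ => -((m + 1 : ℕ) : ℤ)) :=
      sum_mem fun i _ => Submodule.smul_mem _ _ (he i _ hlt).mem_HgeSet
    have hxy : x - y ∈ S := by
      refine ih (fun i q hq hqm => heS i q hq (hqm.trans m.le_succ)) ⟨W.sub_mem hxW hyW, ?_⟩
      intro i c hc
      by_cases hcm : c < -((m + 1 : ℕ) : ℤ)
      · exact (Submodule.sub_mem _ hx hyH) i c hcm
      · obtain rfl : c = -((m + 1 : ℕ) : ℤ) := by push_cast at *; omega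
        rw [← piCoeff_apply, map_sub, hy, map_sum, Finset.sum_eq_single i]
        · rw [map_smul, piCoeff_apply, piCoeff_apply, (he i _ hlt).coeff_self, smul_eq_mul,
            mul_one, sub_self]
        · intro i' _ hi'
          rw [map_smul, piCoeff_apply, (he i' _ hlt).coeff_eq_zero le_rfl
            (fun h => hi' (Prod.ext_iff.1 h).1), smul_zero]
        · simp
    simpa using S.add_mem hxy hyS

theorem Nat.mul_add_inj_of_lt {M a b s t : ℕ} (hs : s < M) (ht : t < M)
    (h : a * M + s = b * M + t) : a = b ∧ s = t := by
  have hM : 0 < M := by omega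
  have hab : a = b := by
    have := congrArg (· / M) h
    simpa [Nat.add_comm _ s, Nat.add_comm _ t, Nat.add_mul_div_right _ _ hM,
      Nat.div_eq_of_lt hs, Nat.div_eq_of_lt ht] using this
  subst hab
  exact ⟨rfl, by omega⟩

/-- The normal monomial with leading term `t_i^{-q}`. -/
noncomputable def normalMonomial {k : Type*} [Field k] {n : ℕ} (N : ℕ)
    (h : Fin n → ℕ → (Fin n → LaurentSeries k)) (i : Fin n) (q : ℕ) :
    Fin n → LaurentSeries k :=
  if q % (N + 1) = 0 then h i 0 ^ (q / (N + 1))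
  else h i 0 ^ (q / (N + 1) - 1) * h i (q % (N + 1))

/-- normal monomials from the Gröbner-basis construction.
Let `W ⊆ H = ∏ k((t_i))` be a `k`-subalgebra with `𝟙 ∈ W` such that:
(1) `H = W + H_{≥(−N,…,−N)}`;
(2) `𝟙, g₁, …, g_r` is a `k`-basis of `W ∩ H_{≥(−N,…,−N)}`;
(3) for `1 ≤ i ≤ n`, `0 ≤ j ≤ N` there is `h_i(j) ∈ W` with pole of order exactly
`N+1+j` in `t_i` (leading coefficient `1`) and poles of order `≤ N` elsewhere.
Setting `f_i := h_i(0)`, the family `𝟙, g_k, f_i^m (m ≥ 1), f_i^m·h_i(j)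
(m ≥ 0, 1 ≤ j ≤ N)` is a `k`-basis of `W`; in particular the `f_i, h_i(j), g_k`
generate `W` as a `k`-algebra.  Moreover for `m ≥ N` the subspace
`W ∩ H_{≥(−m,…,−m)}` is spanned by `𝟙`, the `g_k`, the `f_i^p` with `p(N+1) ≤ m`
and the `f_i^p·h_i(j)` with `1 ≤ j ≤ N` and `(p+1)(N+1)+j ≤ m`. -/
theorem groebner_normal_monomials_basis
    (k : Type*) [Field k] (n : ℕ) (hn : 1 ≤ n) (N : ℕ) (hN : 1 ≤ N)
    (W : Subalgebra k (Fin n → LaurentSeries k))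
    (h1 : ∀ x : Fin n → LaurentSeries k, ∃ w ∈ W,
      x - w ∈ HgeSet k n (fun _ => -(N : ℤ)))
    (r : ℕ) (g : Fin r → (Fin n → LaurentSeries k)) (hg : ∀ kk, g kk ∈ W)
    (gfam : (Fin (r + 1)) → (Fin n → LaurentSeries k))
    (hgfam : gfam = Fin.cons 1 g)
    (hgbasis : LinearIndependent k gfam ∧
      (Submodule.span k (Set.range gfam) : Set (Fin n → LaurentSeries k)) =
        (W : Set (Fin n → LaurentSeries k)) ∩ HgeSet k n (fun _ => -(N : ℤ)))
    (h : Fin n → ℕ → (Fin n → LaurentSeries k))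
    (hhW : ∀ i : Fin n, ∀ j : ℕ, j ≤ N → h i j ∈ W)
    (hhpole : ∀ i : Fin n, ∀ j : ℕ, j ≤ N →
      h i j ∈ HgeSet k n (fun i' => if i' = i then -(N : ℤ) - (1 + j) else -(N : ℤ)))
    (hhlead : ∀ i : Fin n, ∀ j : ℕ, j ≤ N →
      h i j - tPow k n i (-(N : ℤ) - (1 + j)) ∈
        HgeSet k n (fun i' => if i' = i then -(N : ℤ) - j else -(N : ℤ))) :
    letI f : Fin n → (Fin n → LaurentSeries k) := fun i => h i 0
    letI fam : ((Unit ⊕ Fin r) ⊕ ((Fin n × ℕ) ⊕ (Fin n × ℕ × Fin N))) →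
        (Fin n → LaurentSeries k) := fun x =>
      match x with
      | Sum.inl (Sum.inl _) => 1
      | Sum.inl (Sum.inr kk) => g kk
      | Sum.inr (Sum.inl (i, m)) => (f i) ^ (m + 1)
      | Sum.inr (Sum.inr (i, m, j)) => (f i) ^ m * h i ((j : ℕ) + 1)
    (LinearIndependent k fam ∧
      (Submodule.span k (Set.range fam) : Set (Fin n → LaurentSeries k)) =
        (W : Set (Fin n → LaurentSeries k))) ∧
    Algebra.adjoin k
      ({x | ∃ (i : Fin n) (j : ℕ), j ≤ N ∧ x = h i j} ∪ {x | ∃ kk, x = g kk}) = W ∧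
    (∀ m : ℕ, N ≤ m →
      (W : Set (Fin n → LaurentSeries k)) ∩ HgeSet k n (fun _ => -(m : ℤ)) =
        (Submodule.span k
          ({(1 : Fin n → LaurentSeries k)} ∪ {x | ∃ kk, x = g kk} ∪
            {x | ∃ (i : Fin n) (p : ℕ), p * (N + 1) ≤ m ∧ x = (f i) ^ p} ∪
            {x | ∃ (i : Fin n) (p j : ℕ), 1 ≤ j ∧ j ≤ N ∧
              (p + 1) * (N + 1) + j ≤ m ∧ x = (f i) ^ p * h i j}) :
          Set (Fin n → LaurentSeries k))) := by
  let f : Fin n → (Fin n → LaurentSeries k) := fun i => h i 0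
  let fam : ((Unit ⊕ Fin r) ⊕ ((Fin n × ℕ) ⊕ (Fin n × ℕ × Fin N))) →
      (Fin n → LaurentSeries k) := fun x =>
    match x with
    | Sum.inl (Sum.inl _) => 1
    | Sum.inl (Sum.inr kk) => g kk
    | Sum.inr (Sum.inl (i, m)) => (f i) ^ (m + 1)
    | Sum.inr (Sum.inr (i, m, j)) => (f i) ^ m * h i ((j : ℕ) + 1)
  change (LinearIndependent k fam ∧ (Submodule.span k (Set.range fam) :
    Set (Fin n → LaurentSeries k)) = (W : Set (Fin n → LaurentSeries k))) ∧ _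
  have hlead : ∀ i j, j ≤ N → HasLead i (N + 1 + j) (h i j) := by
    intro i j hj
    refine ⟨?_, fun m hm => hhpole i j hj i m ?_, fun i' hi' m hm => hhpole i j hj i' m ?_⟩
    · have hl := hhlead i j hj i (-(N : ℤ) - (1 + j)) (by simp)
      rw [← piCoeff_apply, map_sub, piCoeff_apply, piCoeff_apply, sub_eq_zero] at hl
      rw [show -((N + 1 + j : ℕ) : ℤ) = -(N : ℤ) - (1 + j) by push_cast; ring, hl]
      simp [tPow]
    · simp only [if_pos]
      push_cast at hm
      omega
    · simp only [if_neg hi']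
      push_cast at hm
      omega
  have hleadf : ∀ i m, HasLead i ((m + 1) * (N + 1)) (f i ^ (m + 1)) := fun i m => by
    have := (hlead i 0 (Nat.zero_le _)).pow_mul (hlead i 0 (Nat.zero_le _)) m
    rwa [← pow_succ, add_zero, ← Nat.succ_mul] at this
  have hleadh : ∀ i m j, j ≤ N → HasLead i ((m + 1) * (N + 1) + j) (f i ^ m * h i j) :=
    fun i m j hj => by
      have := (hlead i 0 (Nat.zero_le _)).pow_mul (hlead i j hj) m
      rwa [add_zero, ← add_assoc, ← Nat.succ_mul] at this
  have hfW : ∀ i, f i ∈ W := fun i => hhW i 0 (Nat.zero_le _)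
  have hgspan : Submodule.span k (Set.range gfam) =
      W.toPiSubmodule ⊓ HgeSubmodule k n (fun _ => -(N : ℤ)) :=
    SetLike.coe_injective hgbasis.2
  have hrange : Set.range gfam = {(1 : Fin n → LaurentSeries k)} ∪ {x | ∃ kk, x = g kk} := by
    rw [hgfam, Fin.range_cons]
    ext x
    simp [eq_comm]
  have hmemN : ∀ a, gfam a ∈ HgeSet k n (fun _ => -(N : ℤ)) := fun a =>
    (hgspan.le (Submodule.subset_span ⟨a, rfl⟩)).2
  have hcase : ∀ i q, N < q →
      (∃ p, q = (p + 1) * (N + 1) ∧ normalMonomial N h i q = f i ^ (p + 1)) ∨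
      ∃ p j, 1 ≤ j ∧ j ≤ N ∧ q = (p + 1) * (N + 1) + j ∧
        normalMonomial N h i q = f i ^ p * h i j := by
    intro i q hq
    have hdiv : 1 ≤ q / (N + 1) := (Nat.one_le_div_iff (Nat.succ_pos N)).2 hq
    obtain ⟨p, hp⟩ := Nat.exists_eq_add_of_le' hdiv
    have hdm := Nat.div_add_mod' q (N + 1)
    have hlt := Nat.mod_lt q N.add_one_pos
    rw [hp] at hdm
    by_cases h0 : q % (N + 1) = 0
    · left
      exact ⟨p, by rw [← hdm, h0, add_zero], by rw [normalMonomial, if_pos h0, hp]⟩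
    · right
      exact ⟨p, q % (N + 1), by omega, by omega, hdm.symm,
        by rw [normalMonomial, if_neg h0, hp, Nat.add_sub_cancel]⟩
  have heW : ∀ i q, N < q → normalMonomial N h i q ∈ W.toPiSubmodule := by
    intro i q hq
    rw [Subalgebra.mem_toPiSubmodule]
    rcases hcase i q hq with ⟨p, -, hp⟩ | ⟨p, j, -, hj, -, hp⟩
    · exact hp ▸ pow_mem (hfW i) _
    · exact hp ▸ mul_mem (pow_mem (hfW i) _) (hhW i j hj)
  have he : ∀ i q, N < q → HasLead i q (normalMonomial N h i q) := by
    intro i q hq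
    rcases hcase i q hq with ⟨p, hq', hp⟩ | ⟨p, j, -, hj, hq', hp⟩
    · rw [hp, hq']
      exact hleadf i p
    · rw [hp, hq']
      exact hleadh i p j hj
  have hspan := le_of_forall_hasLead W.toPiSubmodule _ heW he
  have hWle : ∀ S : Submodule k (Fin n → LaurentSeries k), (1 ∈ S) → (∀ kk, g kk ∈ S) →
      (∀ i m, f i ^ (m + 1) ∈ S) → (∀ i m j, 1 ≤ j → j ≤ N → f i ^ m * h i j ∈ S) →
      W.toPiSubmodule ≤ S := by
    intro S h1S hgS hfS hhS x hx
    obtain ⟨m, hm, hxm⟩ := exists_mem_HgeSet x N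
    refine hspan m hm S ?_ (fun i q hq _ => ?_) ⟨hx, hxm⟩
    · rw [← hgspan, Submodule.span_le, hrange]
      rintro _ (rfl | ⟨kk, rfl⟩)
      exacts [h1S, hgS kk]
    · rcases hcase i q hq with ⟨p, -, hp⟩ | ⟨p, j, hj1, hj, -, hp⟩
      · exact hp ▸ hfS i p
      · exact hp ▸ hhS i p j hj1 hj
  refine ⟨⟨?_, ?_⟩, ?_, ?_⟩
  · have hfam : fam = Sum.elim (gfam ∘ Sum.elim (fun _ : Unit => 0) Fin.succ)
        (fun b => fam (Sum.inr b)) := by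
      funext x
      rcases x with (_ | kk) | b
      · simp [fam, hgfam]
      · simp [fam, hgfam]
      · rfl
    let ord : (Fin n × ℕ) ⊕ (Fin n × ℕ × Fin N) → Fin n × ℕ :=
      Sum.elim (fun b => (b.1, (b.2 + 1) * (N + 1)))
        (fun b => (b.1, (b.2.1 + 1) * (N + 1) + (b.2.2 + 1)))
    have hord : Function.Injective ord := by
      rintro (⟨i, m⟩ | ⟨i, m, j⟩) (⟨i', m'⟩ | ⟨i', m', j'⟩) heq <;>
        obtain ⟨hi, hq⟩ := Prod.ext_iff.1 heq <;>
        simp only [ord, Sum.elim_inl, Sum.elim_inr] at hi hq <;> subst hi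
      · have := Nat.mul_add_inj_of_lt (a := m + 1) (b := m' + 1) (M := N + 1)
          (s := 0) (t := 0) (by omega) (by omega) hq
        obtain rfl : m = m' := by omega
        rfl
      · have := Nat.mul_add_inj_of_lt (a := m + 1) (b := m' + 1) (M := N + 1)
          (s := 0) (by omega) (Nat.succ_lt_succ j'.2) hq
        omega
      · have := Nat.mul_add_inj_of_lt (a := m + 1) (b := m' + 1) (M := N + 1)
          (t := 0) (Nat.succ_lt_succ j.2) (by omega) hq
        omega
      · have := Nat.mul_add_inj_of_lt (Nat.succ_lt_succ j.2) (Nat.succ_lt_succ j'.2) hq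
        obtain rfl : m = m' := by omega
        obtain rfl : j = j' := Fin.ext (by omega)
        rfl
    have hordlead : ∀ b, HasLead (ord b).1 (ord b).2 (fam (Sum.inr b)) := by
      rintro (⟨i, m⟩ | ⟨i, m, j⟩)
      · exact hleadf i m
      · exact hleadh i m (j + 1) j.2
    have hordN : ∀ b, N < (ord b).2 := by
      rintro (⟨i, m⟩ | ⟨i, m, j⟩) <;> simp only [ord, Sum.elim_inl, Sum.elim_inr] <;> nlinarith
    rw [hfam]
    refine LinearIndependent.sumElim_of_triangular (hgbasis.1.comp _ ?_) _
      (fun b => piCoeff k n (ord b).1 (-((ord b).2 : ℤ))) (fun b => (ord b).2)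
      (fun b a => ?_) (fun b => (hordlead b).coeff_self) fun b b' hle hne => ?_
    · rintro (_ | a) (_ | a') haa
      · rfl
      · exact absurd haa.symm (Fin.succ_ne_zero a')
      · exact absurd haa (Fin.succ_ne_zero a)
      · rw [Fin.succ_injective _ haa]
    · have := hordN b
      exact hmemN _ _ _ (by simp only; omega)
    · exact (hordlead b').coeff_eq_zero hle fun heq => hne (hord heq)
  · change _ = (W.toPiSubmodule : Set (Fin n → LaurentSeries k))
    refine congrArg _ (le_antisymm (Submodule.span_le.2 ?_) (hWle _ ?_ ?_ ?_ ?_))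
    · rintro _ ⟨(_ | kk) | ⟨i, m⟩ | ⟨i, m, j⟩, rfl⟩
      · exact one_mem W
      · exact hg kk
      · exact pow_mem (hfW i) _
      · exact W.mul_mem (pow_mem (hfW i) _) (hhW i _ j.2)
    · exact Submodule.subset_span ⟨Sum.inl (Sum.inl ()), rfl⟩
    · exact fun kk => Submodule.subset_span ⟨Sum.inl (Sum.inr kk), rfl⟩
    · exact fun i m => Submodule.subset_span ⟨Sum.inr (Sum.inl (i, m)), rfl⟩
    · intro i m j hj1 hj
      obtain ⟨j, rfl⟩ := Nat.exists_eq_add_of_le' hj1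
      exact Submodule.subset_span ⟨Sum.inr (Sum.inr (i, m, ⟨j, hj⟩)), rfl⟩
  · refine le_antisymm (Algebra.adjoin_le ?_) ?_
    · rintro _ (⟨i, j, hj, rfl⟩ | ⟨kk, rfl⟩)
      exacts [hhW i j hj, hg kk]
    · have hh : ∀ i j, j ≤ N → h i j ∈ Algebra.adjoin k
          ({x | ∃ (i : Fin n) (j : ℕ), j ≤ N ∧ x = h i j} ∪ {x | ∃ kk, x = g kk}) :=
        fun i j hj => Algebra.subset_adjoin (Or.inl ⟨i, j, hj, rfl⟩)
      exact hWle (Algebra.adjoin k _ |>.toPiSubmodule) (Subalgebra.one_mem _)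
        (fun kk => Algebra.subset_adjoin (Or.inr ⟨kk, rfl⟩))
        (fun i m => pow_mem (hh i 0 (Nat.zero_le _)) _)
        (fun i m j _ hj => Subalgebra.mul_mem _ (pow_mem (hh i 0 (Nat.zero_le _)) _) (hh i j hj))
  · intro m hm
    change ((W.toPiSubmodule ⊓ HgeSubmodule k n (fun _ => -(m : ℤ)) :
      Submodule k _) : Set (Fin n → LaurentSeries k)) = _
    refine congrArg _ (le_antisymm (hspan m hm _ ?_ fun i q hq hqm => ?_) (Submodule.span_le.2 ?_))
    · rw [← hgspan, hrange]
      exact Submodule.span_mono fun x hx => Or.inl (Or.inl hx)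
    · rcases hcase i q hq with ⟨p, hq', hp⟩ | ⟨p, j, hj1, hj, hq', hp⟩
      · exact Submodule.subset_span (Or.inl (Or.inr ⟨i, p + 1, hq' ▸ hqm, hp⟩))
      · exact Submodule.subset_span (Or.inr ⟨i, p, j, hj1, hj, hq' ▸ hqm, hp⟩)
    · have hmono : ∀ q : ℕ, q ≤ m →
          HgeSet k n (fun _ => -(q : ℤ)) ⊆ HgeSet k n (fun _ => -(m : ℤ)) :=
        fun q hqm => HgeSet_anti fun _ => by simp only; omega
      have h1mem : (1 : Fin n → LaurentSeries k) ∈ HgeSet k n (fun _ => -(m : ℤ)) := by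
        have := hmemN 0
        rw [hgfam, Fin.cons_zero] at this
        exact hmono N hm this
      rintro _ (((rfl | ⟨kk, rfl⟩) | ⟨i, p, hp, rfl⟩) | ⟨i, p, j, -, hj, hp, rfl⟩)
      · exact ⟨one_mem W, h1mem⟩
      · have := hmemN kk.succ
        rw [hgfam, Fin.cons_succ] at this
        exact ⟨hg kk, hmono N hm this⟩
      · refine ⟨pow_mem (hfW i) _, ?_⟩
        cases p with
        | zero => rw [pow_zero]; exact h1mem
        | succ p => exact hmono _ hp (hleadf i p).mem_HgeSet
      · exact ⟨W.mul_mem (pow_mem (hfW i) _) (hhW i j hj),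
          hmono _ hp (hleadh i p j hj).mem_HgeSet⟩
end

section
/- Let R be a commutative ring, M an m × l matrix over R, and r ≥ 0 an integer with r ≤ m and r ≤ l. Assume there exist injections e : Fin r → Fin m and f : Fin r → Fin l such that the determinant of the r × r submatrix of M with rows e and columns f is a unit of R, and that for all injections e' : Fin (r+1) → Fin m and f' : Fin (r+1) → Fin l the determinant of the corresponding (r+1) × (r+1) submatrix of M is zero. Then there exist invertible matrices P ∈ GL_m(R) and Q ∈ GL_l(R) such that P·M·Q is the block matrix with the r × r identity block in the upper-left corner and zeros elsewhere. In particular, the image of the R-linear map R^l → R^m given by M is a free direct summand of R^m of rank r, and its cokernel is free of rank m − r. -/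
/-- An injection from `Fin r` into `Fin m` is the left half of a bijection
`Fin r ⊕ Fin (m - r) ≃ Fin m`. -/
theorem exists_sumEquiv_inl_eq {r m : ℕ} (e : Fin r → Fin m) (he : Function.Injective e) :
    ∃ σ : Fin r ⊕ Fin (m - r) ≃ Fin m, ∀ i, σ (Sum.inl i) = e i := by
  classical
  have hcard : Fintype.card ↥((Set.range e)ᶜ : Set (Fin m)) = m - r := by
    rw [Fintype.card_compl_set, Set.card_range_of_injective he]
    simp
  let τ : Fin (m - r) ≃ ↥((Set.range e)ᶜ : Set (Fin m)) :=
    (Fintype.equivFinOfCardEq hcard).symm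
  exact ⟨(Equiv.sumCongr (Equiv.ofInjective e he) τ).trans (Equiv.Set.sumCompl (Set.range e)),
    fun i => by simp⟩

/-- A bijection `Fin r ⊕ κ ≃ Fin m` extending `Fin.castLE` sends the right summand to the indices
from `r` on. -/
theorem le_apply_inr {r m : ℕ} {κ : Type*} {hrm : r ≤ m} (σ : Fin r ⊕ κ ≃ Fin m)
    (hσ : ∀ i, σ (Sum.inl i) = Fin.castLE hrm i) (a : κ) : r ≤ (σ (Sum.inr a) : ℕ) := by
  by_contra! hlt
  have := σ.injective (hσ ⟨_, hlt⟩ : _ = σ (Sum.inr a))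
  simp at this

namespace Matrix

variable {R : Type*} [CommRing R]

/-- If the upper-left block is invertible and every minor bordering it vanishes, then the
Schur complement vanishes. -/
theorem schur_complement_eq_zero {n p q : Type*} [Fintype n] [DecidableEq n]
    (A : Matrix n n R) [Invertible A] (B : Matrix n q R) (C : Matrix p n R) (D : Matrix p q R)
    (h : ∀ i j, ((fromBlocks A B C D).submatrix (Sum.map id fun _ : Unit => i)
      (Sum.map id fun _ : Unit => j)).det = 0) :
    D = C * ⅟A * B := by
  ext i j
  have hij := h i j
  have hblock : (fromBlocks A B C D).submatrix (Sum.map id fun _ : Unit => i)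
      (Sum.map id fun _ : Unit => j) =
      fromBlocks A (B.submatrix id fun _ => j) (C.submatrix (fun _ => i) id)
        (D.submatrix (fun _ => i) fun _ => j) := by
    ext (a | a) (b | b) <;> rfl
  rw [hblock, det_fromBlocks₁₁, det_unique (n := Unit)] at hij
  have hz := ((isUnit_det_of_invertible A).mul_right_eq_zero).1 hij
  exact sub_eq_zero.1 hz

/-- A block matrix with invertible upper-left block and vanishing Schur complement is equivalent
to the block matrix with an identity block and zeros elsewhere. -/
theorem exists_isUnit_mul_fromBlocks_mul {n p q : Type*} [Fintype n] [Fintype p] [Fintype q]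
    [DecidableEq n] [DecidableEq p] [DecidableEq q]
    (A : Matrix n n R) [Invertible A] (B : Matrix n q R) (C : Matrix p n R) :
    ∃ (P : Matrix (n ⊕ p) (n ⊕ p) R) (Q : Matrix (n ⊕ q) (n ⊕ q) R), IsUnit P ∧ IsUnit Q ∧
      P * fromBlocks A B C (C * ⅟A * B) * Q = fromBlocks 1 0 0 0 := by
  refine ⟨fromBlocks (⅟A) 0 (-(C * ⅟A)) 1, fromBlocks 1 (-(⅟A * B)) 0 1, ?_, ?_, ?_⟩
  · exact isUnit_fromBlocks_zero₁₂.2 ⟨isUnit_of_invertible _, isUnit_one⟩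
  · exact isUnit_fromBlocks_zero₂₁.2 ⟨isUnit_one, isUnit_one⟩
  · simp [fromBlocks_multiply, Matrix.mul_assoc]

/-- The image of a matrix in rank normal form consists of the vectors whose coordinates from
index `r` on vanish, up to the change of basis. -/
theorem mem_range_mulVecLin_iff {m l r : ℕ} (hrl : r ≤ l) (M : Matrix (Fin m) (Fin l) R)
    (P : (Matrix (Fin m) (Fin m) R)ˣ) (Q : (Matrix (Fin l) (Fin l) R)ˣ)
    (h : (P : Matrix (Fin m) (Fin m) R) * M * (Q : Matrix (Fin l) (Fin l) R) =
      Matrix.of fun (i : Fin m) (j : Fin l) =>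
        if (i : ℕ) = (j : ℕ) ∧ (i : ℕ) < r then (1 : R) else 0) (y : Fin m → R) :
    y ∈ LinearMap.range M.mulVecLin ↔
      ∀ i : Fin m, r ≤ (i : ℕ) → ((P : Matrix (Fin m) (Fin m) R) *ᵥ y) i = 0 := by
  constructor
  · rintro ⟨x, rfl⟩ i hi
    have hx : (P : Matrix (Fin m) (Fin m) R) *ᵥ (M *ᵥ x) =
        ((P : Matrix (Fin m) (Fin m) R) * M * (Q : Matrix (Fin l) (Fin l) R)) *ᵥ
          ((↑Q⁻¹ : Matrix (Fin l) (Fin l) R) *ᵥ x) := by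
      rw [mulVec_mulVec, mulVec_mulVec, Matrix.mul_assoc, Q.mul_inv, Matrix.mul_one]
    rw [mulVecLin_apply, hx, h]
    simp [mulVec, dotProduct, not_lt.2 hi]
  · intro hy
    set z := (P : Matrix (Fin m) (Fin m) R) *ᵥ y with hz
    let w : Fin l → R := fun j => if hj : (j : ℕ) < m then z ⟨j, hj⟩ else 0
    have hw : ((P : Matrix (Fin m) (Fin m) R) * M * (Q : Matrix (Fin l) (Fin l) R)) *ᵥ w = z := by
      rw [h]
      ext i
      by_cases hi : (i : ℕ) < r
      · simp only [mulVec, dotProduct, of_apply, hi, and_true, ite_mul, one_mul, zero_mul]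
        rw [Finset.sum_eq_single ⟨i, hi.trans_le hrl⟩]
        · simp [w]
        · intro j _ hj
          exact if_neg fun hij => hj (Fin.ext hij.symm)
        · simp
      · simp [mulVec, dotProduct, hi, hy i (not_lt.1 hi)]
    refine ⟨(Q : Matrix (Fin l) (Fin l) R) *ᵥ w, ?_⟩
    have hy' : y = (↑P⁻¹ : Matrix (Fin m) (Fin m) R) *ᵥ z := by
      rw [hz, mulVec_mulVec, P.inv_mul, one_mulVec]
    rw [hy', ← hw, mulVecLin_apply, mulVec_mulVec, mulVec_mulVec, Matrix.mul_assoc,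
      ← Matrix.mul_assoc (↑P⁻¹ : Matrix (Fin m) (Fin m) R), P.inv_mul, Matrix.one_mul]

end Matrix

/-- A submodule which corresponds to the first factor under an isomorphism with a product is a
direct summand isomorphic to the first factor, with quotient isomorphic to the second. -/
theorem Submodule.isCompl_and_equiv_of_mem_iff {R V E F : Type*} [CommRing R]
    [AddCommGroup V] [AddCommGroup E] [AddCommGroup F] [Module R V] [Module R E] [Module R F]
    (N : Submodule R V) (p : V ≃ₗ[R] E × F) (h : ∀ y, y ∈ N ↔ (p y).2 = 0) :
    (∃ C : Submodule R V, IsCompl N C) ∧ Nonempty (N ≃ₗ[R] E) ∧ Nonempty ((V ⧸ N) ≃ₗ[R] F) := by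
  have hker : N = LinearMap.ker (LinearMap.snd R E F ∘ₗ p.toLinearMap) := by
    ext y
    simp [h]
  refine ⟨⟨LinearMap.ker (LinearMap.fst R E F ∘ₗ p.toLinearMap), ?_⟩, ⟨?_⟩, ⟨?_⟩⟩
  · refine ⟨Submodule.disjoint_def.2 fun y hy hy' => ?_, codisjoint_iff.2 ?_⟩
    · exact p.map_eq_zero_iff.1 (Prod.ext hy' ((h y).1 hy))
    · refine eq_top_iff.2 fun y _ => Submodule.mem_sup.2
        ⟨p.symm ((p y).1, 0), (h _).2 (by simp), p.symm (0, (p y).2), by simp, ?_⟩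
      rw [← map_add]
      simp
  · refine LinearEquiv.ofBijective (LinearMap.fst R E F ∘ₗ p.toLinearMap ∘ₗ N.subtype) ⟨?_, ?_⟩
    · refine (injective_iff_map_eq_zero _).2 fun y hy => ?_
      exact Subtype.ext (p.map_eq_zero_iff.1 (Prod.ext hy ((h y).1 y.2)))
    · exact fun x => ⟨⟨p.symm (x, 0), (h _).2 (by simp)⟩, by simp⟩
  · exact (Submodule.quotEquivOfEq _ _ hker).trans
      (LinearMap.quotKerEquivOfSurjective _ (Prod.snd_surjective.comp p.surjective))


/-- Let `R` be a commutative ring, `M` an `m × l` matrix over `R`, and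
`0 ≤ r ≤ m, l`. Assume some `r × r` minor of `M` is a unit and all `(r+1) × (r+1)`
minors vanish. Then there are invertible matrices `P ∈ GL_m(R)`, `Q ∈ GL_l(R)` with
`P·M·Q` equal to the block matrix with identity `r × r` block in the upper-left corner
and zeros elsewhere. In particular, the image of the linear map `R^l → R^m` given by
`M` is a free direct summand of `R^m` of rank `r`, and its cokernel is free of rank
`m − r`. -/
theorem constant_rank_normal_form {R : Type*} [CommRing R] {m l r : ℕ}
    (hrm : r ≤ m) (hrl : r ≤ l) (M : Matrix (Fin m) (Fin l) R)
    (hunit : ∃ (e : Fin r → Fin m) (f : Fin r → Fin l), Function.Injective e ∧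
      Function.Injective f ∧ IsUnit (M.submatrix e f).det)
    (hzero : ∀ (e' : Fin (r + 1) → Fin m) (f' : Fin (r + 1) → Fin l),
      Function.Injective e' → Function.Injective f' → (M.submatrix e' f').det = 0) :
    (∃ (P : (Matrix (Fin m) (Fin m) R)ˣ) (Q : (Matrix (Fin l) (Fin l) R)ˣ),
      (P : Matrix (Fin m) (Fin m) R) * M * (Q : Matrix (Fin l) (Fin l) R) =
        Matrix.of fun (i : Fin m) (j : Fin l) =>
          if (i : ℕ) = (j : ℕ) ∧ (i : ℕ) < r then (1 : R) else 0) ∧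
    (∃ C : Submodule R (Fin m → R), IsCompl (LinearMap.range M.mulVecLin) C) ∧
    Nonempty ((LinearMap.range M.mulVecLin) ≃ₗ[R] (Fin r → R)) ∧
    Nonempty (((Fin m → R) ⧸ LinearMap.range M.mulVecLin) ≃ₗ[R] (Fin (m - r) → R)) := by
  have hP : ∃ (P : (Matrix (Fin m) (Fin m) R)ˣ) (Q : (Matrix (Fin l) (Fin l) R)ˣ),
      (P : Matrix (Fin m) (Fin m) R) * M * (Q : Matrix (Fin l) (Fin l) R) =
        Matrix.of fun (i : Fin m) (j : Fin l) =>
          if (i : ℕ) = (j : ℕ) ∧ (i : ℕ) < r then (1 : R) else 0 := by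
    obtain ⟨e, f, he, hf, hdet⟩ := hunit
    obtain ⟨σ, hσ⟩ := exists_sumEquiv_inl_eq e he
    obtain ⟨τ, hτ⟩ := exists_sumEquiv_inl_eq f hf
    obtain ⟨σ₀, hσ₀⟩ := exists_sumEquiv_inl_eq (Fin.castLE hrm) (Fin.castLE_injective hrm)
    obtain ⟨τ₀, hτ₀⟩ := exists_sumEquiv_inl_eq (Fin.castLE hrl) (Fin.castLE_injective hrl)
    set N := M.submatrix σ τ with hN
    have hA : N.toBlocks₁₁ = M.submatrix e f := by
      ext i j
      simp [hN, Matrix.toBlocks₁₁, hσ, hτ]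
    let _ : Invertible N.toBlocks₁₁ :=
      Matrix.invertibleOfIsUnitDet _ (by rwa [hA])
    have hD : N.toBlocks₂₂ = N.toBlocks₂₁ * ⅟N.toBlocks₁₁ * N.toBlocks₁₂ := by
      refine Matrix.schur_complement_eq_zero _ _ _ _ fun i j => ?_
      let g : Fin (r + 1) ≃ Fin r ⊕ Unit :=
        finSumFinEquiv.symm.trans (Equiv.sumCongr (Equiv.refl _) (Equiv.equivPUnit _))
      rw [Matrix.fromBlocks_toBlocks, ← Matrix.det_submatrix_equiv_self g]
      refine hzero (σ ∘ Sum.map id (fun _ => i) ∘ g) (τ ∘ Sum.map id (fun _ => j) ∘ g) ?_ ?_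
      · exact σ.injective.comp ((Function.injective_id.sumMap
          (Function.injective_of_subsingleton _)).comp g.injective)
      · exact τ.injective.comp ((Function.injective_id.sumMap
          (Function.injective_of_subsingleton _)).comp g.injective)
    obtain ⟨P, Q, hP, hQ, hPQ⟩ :=
      Matrix.exists_isUnit_mul_fromBlocks_mul N.toBlocks₁₁ N.toBlocks₁₂ N.toBlocks₂₁
    rw [← hD, Matrix.fromBlocks_toBlocks] at hPQ
    refine ⟨((Matrix.isUnit_submatrix_equiv σ₀.symm σ.symm).2 hP).unit,
      ((Matrix.isUnit_submatrix_equiv τ.symm τ₀.symm).2 hQ).unit, ?_⟩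
    have hM : M = N.submatrix σ.symm τ.symm := by simp [hN]
    rw [IsUnit.unit_spec, IsUnit.unit_spec, hM, Matrix.submatrix_mul_equiv,
      Matrix.submatrix_mul_equiv, hPQ]
    ext i j
    obtain ⟨i, rfl⟩ := σ₀.surjective i
    obtain ⟨j, rfl⟩ := τ₀.surjective j
    rw [Matrix.submatrix_apply, Equiv.symm_apply_apply, Equiv.symm_apply_apply]
    have hi := le_apply_inr σ₀ hσ₀
    have hj := le_apply_inr τ₀ hτ₀
    rcases i with a | a <;> rcases j with b | b
    · simp [hσ₀, hτ₀, Matrix.one_apply, Fin.ext_iff]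
    · have := hj b
      simp only [Matrix.fromBlocks_apply₁₂, Matrix.zero_apply, Matrix.of_apply]
      rw [if_neg (by omega)]
    · simp [(hi a).not_gt]
    · simp [(hi a).not_gt]
  refine ⟨hP, ?_⟩
  obtain ⟨P, Q, hPQ⟩ := hP
  obtain ⟨σ₀, hσ₀⟩ := exists_sumEquiv_inl_eq (Fin.castLE hrm) (Fin.castLE_injective hrm)
  let p : (Fin m → R) ≃ₗ[R] (Fin r → R) × (Fin (m - r) → R) :=
    (Matrix.toLin'OfInv P.inv_mul P.mul_inv).trans
      ((LinearEquiv.funCongrLeft R R σ₀).trans (LinearEquiv.sumArrowLequivProdArrow _ _ R R))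
  refine Submodule.isCompl_and_equiv_of_mem_iff _ p fun y => ?_
  rw [Matrix.mem_range_mulVecLin_iff hrl M P Q hPQ]
  have hp : ∀ a, (p y).2 a =
      (P : Matrix (Fin m) (Fin m) R).mulVec y (σ₀ (Sum.inr a)) := fun a => rfl
  constructor
  · exact fun h => funext fun a => (hp a).trans (h _ (le_apply_inr σ₀ hσ₀ a))
  · intro h i hi
    obtain ⟨i, rfl⟩ := σ₀.surjective i
    rcases i with a | a
    · rw [hσ₀, Fin.val_castLE] at hi
      exact absurd a.2 hi.not_gt
    · rw [← hp, h, Pi.zero_apply]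
end

section
/- Let R be a commutative ring, s ∈ R a non-zero-divisor, and 0 → V₁ →^ι V₂ →^π V₃ → 0 a short exact sequence of R-modules (ι injective, π surjective, ker π = im ι). Suppose the localized sequence splits: let σ : (V₃)_s → (V₂)_s be an R_s-linear map with π_s ∘ σ = id, and let ρ : (V₂)_s → (V₁)_s be the associated retraction, i.e. the unique R_s-linear map with ρ ∘ ι_s = id and ρ ∘ σ = 0. Then the following are equivalent: (a) there exists an R-linear map σ' : V₃ → V₂ with π ∘ σ' = s·id_{V₃} and ε ∘ σ' = s·(σ ∘ ε); (b) there exists an R-linear map ρ' : V₂ → V₁ with ρ' ∘ ι = s·id_{V₁} and ε ∘ ρ' = s·(ρ ∘ ε). -/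
/-- Let `R` be a commutative ring, `s ∈ R` a non-zero-divisor, and
`0 → V₁ →^ι V₂ →^π V₃ → 0` a short exact sequence of `R`-modules. Suppose the
localized sequence at the powers of `s` splits, with section `σ` and associated
retraction `ρ`. Then the following are equivalent:
(a) there exists `σ' : V₃ → V₂` with `π ∘ σ' = s·id` and `ε ∘ σ' = s·(σ ∘ ε)`;
(b) there exists `ρ' : V₂ → V₁` with `ρ' ∘ ι = s·id` and `ε ∘ ρ' = s·(ρ ∘ ε)`. -/
theorem splitting_with_pole_iff_retraction_with_pole
    {R V₁ V₂ V₃ : Type*} [CommRing R]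
    [AddCommGroup V₁] [AddCommGroup V₂] [AddCommGroup V₃]
    [Module R V₁] [Module R V₂] [Module R V₃]
    (s : R) (hs : s ∈ nonZeroDivisors R)
    (ι : V₁ →ₗ[R] V₂) (π : V₂ →ₗ[R] V₃)
    (hι : Function.Injective ι) (hπ : Function.Surjective π)
    (hexact : LinearMap.ker π = LinearMap.range ι)
    (σ : LocalizedModule (Submonoid.powers s) V₃
      →ₗ[Localization (Submonoid.powers s)] LocalizedModule (Submonoid.powers s) V₂)
    (hσ : ∀ x, LocalizedModule.map (Submonoid.powers s) π (σ x) = x)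
    (ρ : LocalizedModule (Submonoid.powers s) V₂
      →ₗ[Localization (Submonoid.powers s)] LocalizedModule (Submonoid.powers s) V₁)
    (hρι : ∀ x, ρ (LocalizedModule.map (Submonoid.powers s) ι x) = x)
    (hρσ : ∀ y, ρ (σ y) = 0) :
    (∃ σ' : V₃ →ₗ[R] V₂, (∀ x : V₃, π (σ' x) = s • x) ∧
      ∀ x : V₃, LocalizedModule.mkLinearMap (Submonoid.powers s) V₂ (σ' x) =
        s • σ (LocalizedModule.mkLinearMap (Submonoid.powers s) V₃ x)) ↔
    (∃ ρ' : V₂ →ₗ[R] V₁, (∀ v : V₁, ρ' (ι v) = s • v) ∧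
      ∀ x : V₂, LocalizedModule.mkLinearMap (Submonoid.powers s) V₁ (ρ' x) =
        s • ρ (LocalizedModule.mkLinearMap (Submonoid.powers s) V₂ x)) := by
  have map_ε_ι (v : V₁) : LocalizedModule.map (Submonoid.powers s) ι
      (LocalizedModule.mkLinearMap (Submonoid.powers s) V₁ v) =
      LocalizedModule.mkLinearMap (Submonoid.powers s) V₂ (ι v) :=
    LocalizedModule.map_mk _ _ _ _
  have map_ε_π (x : V₂) : LocalizedModule.map (Submonoid.powers s) π
      (LocalizedModule.mkLinearMap (Submonoid.powers s) V₂ x) =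
      LocalizedModule.mkLinearMap (Submonoid.powers s) V₃ (π x) :=
    LocalizedModule.map_mk _ _ _ _
  have ι_exact_π : Function.Exact ι π := LinearMap.exact_iff.mpr hexact
  have exact_map : Function.Exact (LocalizedModule.map (Submonoid.powers s) ι)
      (LocalizedModule.map (Submonoid.powers s) π) :=
    LocalizedModule.map_exact (Submonoid.powers s) ι π ι_exact_π
  constructor
  · rintro ⟨σ', hπσ', hεσ'⟩
    let e := LinearEquiv.ofInjective ι hι
    have mem_range (x : V₂) :
        (s • LinearMap.id - σ' ∘ₗ π : V₂ →ₗ[R] V₂) x ∈ LinearMap.range ι := by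
      rw [← hexact]
      simp [hπσ']
    let ρ' : V₂ →ₗ[R] V₁ :=
      e.symm.toLinearMap ∘ₗ (s • LinearMap.id - σ' ∘ₗ π).codRestrict _ mem_range
    have hιρ' (x : V₂) : ι (ρ' x) = s • x - σ' (π x) :=
      congrArg Subtype.val (e.apply_symm_apply ⟨_, mem_range x⟩)
    refine ⟨ρ', fun v ↦ hι ?_, fun x ↦ ?_⟩
    · rw [hιρ', ι_exact_π.apply_apply_eq_zero]
      simp
    · rw [← hρι (LocalizedModule.mkLinearMap _ V₁ (ρ' x)), map_ε_ι, hιρ', map_sub, map_smul,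
        hεσ', map_sub, LinearMap.map_smul_of_tower, LinearMap.map_smul_of_tower, hρσ, smul_zero,
        sub_zero]
  · rintro ⟨ρ', hρ'ι, hερ'⟩
    have decomposition (y : LocalizedModule (Submonoid.powers s) V₂) :
        y - LocalizedModule.map (Submonoid.powers s) ι (ρ y) =
          σ (LocalizedModule.map (Submonoid.powers s) π y) := by
      obtain ⟨z, hz⟩ := (exact_map
        (y - σ (LocalizedModule.map (Submonoid.powers s) π y))).mp (by rw [map_sub, hσ, sub_self])
      have hρy : ρ y = z := by
        rw [← hρι z, hz, map_sub, hρσ, sub_zero]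
      rw [hρy, hz, sub_sub_cancel]
    have ker_le : LinearMap.ker π ≤ LinearMap.ker (s • LinearMap.id - ι ∘ₗ ρ' : V₂ →ₗ[R] V₂) := by
      rw [hexact]
      rintro _ ⟨v, rfl⟩
      simp [hρ'ι]
    let σ' : V₃ →ₗ[R] V₂ := (LinearMap.ker π).liftQ (s • LinearMap.id - ι ∘ₗ ρ') ker_le ∘ₗ
      (π.quotKerEquivOfSurjective hπ).symm.toLinearMap
    have hσ'π (x : V₂) : σ' (π x) = s • x - ι (ρ' x) := by
      have : (π.quotKerEquivOfSurjective hπ).symm (π x) = (LinearMap.ker π).mkQ x :=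
        (LinearEquiv.symm_apply_eq _).mpr rfl
      simp [σ', this]
    refine ⟨σ', fun z ↦ ?_, fun z ↦ ?_⟩ <;> obtain ⟨x, rfl⟩ := hπ z
    · rw [hσ'π, map_sub, ι_exact_π.apply_apply_eq_zero, sub_zero, map_smul]
    · rw [hσ'π, map_sub, map_smul, ← map_ε_ι, hερ', LinearMap.map_smul_of_tower, ← smul_sub,
        decomposition, map_ε_π]
end

section
/- (a) C_a contains every standard basis vector e_i; consequently, for all indices i, j ∈ {1,…,n} (possibly equal) and all integers p ≤ −a_i − 1 and q ≥ −a_j, the vector −p·e_i + q·e_j lies in C_a. (b) If a_i > 0 for at least two indices i, then C_a equals the convex cone generated by the vectors ω_{ij} with i ≠ j and a_j > 0. (c) If a = g·e₁ (i.e. a₁ = g ≥ 1 and a_j = 0 for all j ≥ 2), then C_a equals the convex cone generated by e₁ together with the vectors ω_{i1}, i = 2,…,n. -/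
/-- The standard basis vector `e_i` of `ℝⁿ`. -/
noncomputable def stdVec {n : ℕ} (i : Fin n) : Fin n → ℝ := Pi.single i (1 : ℝ)

/-- The vector `ω_{ij} = (a_i+1)·e_i − a_j·e_j ∈ ℝⁿ`. -/
noncomputable def omegaVec {n : ℕ} (a : Fin n → ℕ) (i j : Fin n) : Fin n → ℝ :=
  ((a i : ℝ) + 1) • stdVec i - (a j : ℝ) • stdVec j

/-- The convex cone `C_a ⊆ ℝⁿ` generated by the vectors `ω_{ij}` with `i ≠ j`:
all linear combinations of the `ω_{ij}` (`i ≠ j`) with nonnegative real coefficients. -/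
noncomputable def coneCa {n : ℕ} (a : Fin n → ℕ) : Set (Fin n → ℝ) :=
  {x | ∃ c : Fin n → Fin n → ℝ, (∀ i j, 0 ≤ c i j) ∧ (∀ i, c i i = 0) ∧
    x = ∑ i, ∑ j, c i j • omegaVec a i j}

theorem PointedCone.mem_hull_image_iff_exists_sum {ι E : Type*} [Fintype ι] [AddCommGroup E]
    [Module ℝ E] (v : ι → E) (S : Set ι) (x : E) :
    x ∈ PointedCone.hull ℝ (v '' S) ↔
      ∃ c : ι → ℝ, (∀ i, 0 ≤ c i) ∧ (∀ i, i ∉ S → c i = 0) ∧ x = ∑ i, c i • v i := by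
  classical
  constructor
  · intro hx
    induction hx using Submodule.span_induction with
    | mem x hx =>
      obtain ⟨i, hi, rfl⟩ := hx
      refine ⟨Pi.single i 1, fun j => ?_, fun j hj => ?_, ?_⟩
      · by_cases h : j = i
        · subst h; simp
        · simp [h]
      · have h : j ≠ i := fun h => hj (h ▸ hi)
        simp [h]
      · simp [Pi.single_apply, ite_smul]
    | zero => exact ⟨0, by simp⟩
    | add x y _ _ hx hy =>
      obtain ⟨c, hc, hcS, rfl⟩ := hx
      obtain ⟨d, hd, hdS, rfl⟩ := hy
      exact ⟨c + d, fun i => add_nonneg (hc i) (hd i), fun i hi => by simp [hcS i hi, hdS i hi],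
        by simp [add_smul, Finset.sum_add_distrib]⟩
    | smul r x _ hx =>
      obtain ⟨c, hc, hcS, rfl⟩ := hx
      refine ⟨fun i => r * c i, fun i => mul_nonneg r.2 (hc i), fun i hi => by simp [hcS i hi], ?_⟩
      simp only [Finset.smul_sum, mul_smul]
      rfl
  · rintro ⟨c, hc, hcS, rfl⟩
    refine sum_mem fun i _ => ?_
    by_cases hi : i ∈ S
    · exact PointedCone.smul_mem _ (hc i) (Submodule.subset_span ⟨i, hi, rfl⟩)
    · simp [hcS i hi]

/-- The convex cone generated by the vectors `ω_{ij}` over the pairs `(i, j)` in `S`. -/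
noncomputable def omegaCone {n : ℕ} (a : Fin n → ℕ) (S : Set (Fin n × Fin n)) :
    PointedCone ℝ (Fin n → ℝ) :=
  PointedCone.hull ℝ ((fun p : Fin n × Fin n => omegaVec a p.1 p.2) '' S)

section omegaCone

variable {n : ℕ} {a : Fin n → ℕ} {S : Set (Fin n × Fin n)} {i j : Fin n}

theorem omegaVec_mem_omegaCone (h : (i, j) ∈ S) : omegaVec a i j ∈ omegaCone a S :=
  Submodule.subset_span ⟨(i, j), h, rfl⟩

theorem omegaCone_le {K : PointedCone ℝ (Fin n → ℝ)}
    (h : ∀ i j, (i, j) ∈ S → omegaVec a i j ∈ K) : omegaCone a S ≤ K := by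
  refine Submodule.span_le.2 ?_
  rintro _ ⟨⟨i, j⟩, hij, rfl⟩
  exact h i j hij

theorem mem_omegaCone_iff {x : Fin n → ℝ} :
    x ∈ omegaCone a S ↔ ∃ c : Fin n → Fin n → ℝ, (∀ i j, 0 ≤ c i j) ∧
      (∀ i j, (i, j) ∉ S → c i j = 0) ∧ x = ∑ i, ∑ j, c i j • omegaVec a i j := by
  rw [omegaCone, PointedCone.mem_hull_image_iff_exists_sum]
  constructor
  · rintro ⟨c, hc, hcS, rfl⟩
    exact ⟨fun i j => c (i, j), fun i j => hc _, fun i j h => hcS _ h, Fintype.sum_prod_type _⟩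
  · rintro ⟨c, hc, hcS, rfl⟩
    exact ⟨fun p => c p.1 p.2, fun p => hc _ _, fun p h => hcS _ _ h,
      by rw [Fintype.sum_prod_type]⟩

theorem coneCa_eq_omegaCone (a : Fin n → ℕ) :
    coneCa a = (omegaCone a {p | p.1 ≠ p.2} : Set (Fin n → ℝ)) := by
  ext x
  rw [SetLike.mem_coe, mem_omegaCone_iff]
  simp [coneCa]

/-- If `ω_{ij}` and `e_j` lie in a convex cone, so does `e_i`. -/
theorem stdVec_mem_of_omegaVec_mem {K : PointedCone ℝ (Fin n → ℝ)} (h : omegaVec a i j ∈ K)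
    (hj : stdVec j ∈ K) : stdVec i ∈ K := by
  rw [← PointedCone.smul_mem_iff K (c := (a i : ℝ) + 1) (by positivity)]
  have := K.add_mem h (PointedCone.smul_mem K (r := (a j : ℝ)) (by positivity) hj)
  simpa [omegaVec] using this

/-- If `ω_{ij}` and `ω_{ji}` lie in a convex cone, so does `e_i`. -/
theorem stdVec_mem_of_omegaVec_mem_of_omegaVec_mem {K : PointedCone ℝ (Fin n → ℝ)}
    (hij : omegaVec a i j ∈ K) (hji : omegaVec a j i ∈ K) : stdVec i ∈ K := by
  rw [← PointedCone.smul_mem_iff K (c := (a i : ℝ) + a j + 1) (by positivity)]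
  have := K.add_mem (PointedCone.smul_mem K (r := (a j : ℝ) + 1) (by positivity) hij)
    (PointedCone.smul_mem K (r := (a j : ℝ)) (by positivity) hji)
  convert this using 1
  simp only [omegaVec]
  module

theorem omegaVec_mem_of_stdVec_mem {K : PointedCone ℝ (Fin n → ℝ)} (hi : stdVec i ∈ K)
    (hj : a j = 0) : omegaVec a i j ∈ K := by
  have := PointedCone.smul_mem K (r := (a i : ℝ) + 1) (by positivity) hi
  simpa [omegaVec, hj] using this

theorem stdVec_mem_omegaCone_ne (hn : 2 ≤ n) (a : Fin n → ℕ) (i : Fin n) :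
    stdVec i ∈ omegaCone a {p | p.1 ≠ p.2} := by
  have : Nontrivial (Fin n) := Fin.nontrivial_iff_two_le.2 hn
  obtain ⟨j, hj⟩ := exists_ne i
  exact stdVec_mem_of_omegaVec_mem_of_omegaVec_mem (omegaVec_mem_omegaCone hj.symm)
    (omegaVec_mem_omegaCone hj)

theorem stdVec_mem_omegaCone_pos (h : ∃ i j : Fin n, i ≠ j ∧ 0 < a i ∧ 0 < a j) (i : Fin n) :
    stdVec i ∈ omegaCone a {p | p.1 ≠ p.2 ∧ 0 < a p.2} := by
  obtain ⟨k, l, hkl, hk, hl⟩ := h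
  have hk' : stdVec k ∈ omegaCone a {p | p.1 ≠ p.2 ∧ 0 < a p.2} :=
    stdVec_mem_of_omegaVec_mem_of_omegaVec_mem (omegaVec_mem_omegaCone ⟨hkl, hl⟩)
      (omegaVec_mem_omegaCone ⟨hkl.symm, hk⟩)
  by_cases hik : i = k
  · exact hik ▸ hk'
  · exact stdVec_mem_of_omegaVec_mem (omegaVec_mem_omegaCone ⟨hik, hk⟩) hk'

theorem omegaCone_ne_eq_omegaCone_pos (h : ∃ i j : Fin n, i ≠ j ∧ 0 < a i ∧ 0 < a j) :
    omegaCone a {p | p.1 ≠ p.2} = omegaCone a {p | p.1 ≠ p.2 ∧ 0 < a p.2} := by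
  refine le_antisymm (omegaCone_le fun i j hij => ?_)
    (omegaCone_le fun i j hij => omegaVec_mem_omegaCone hij.1)
  rcases Nat.eq_zero_or_pos (a j) with hj | hj
  · exact omegaVec_mem_of_stdVec_mem (stdVec_mem_omegaCone_pos h i) hj
  · exact omegaVec_mem_omegaCone ⟨hij, hj⟩

theorem smul_stdVec_add_smul_stdVec_mem_omegaCone (hn : 2 ≤ n) (a : Fin n → ℕ) (i j : Fin n)
    {s t : ℝ} (hs : (a i : ℝ) + 1 ≤ s) (ht : -(a j : ℝ) ≤ t) :
    s • stdVec i + t • stdVec j ∈ omegaCone a {p | p.1 ≠ p.2} := by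
  have he := stdVec_mem_omegaCone_ne hn a
  by_cases hij : i = j
  · subst hij
    rw [← add_smul]
    exact PointedCone.smul_mem _ (by linarith) (he i)
  · have := add_mem (add_mem (omegaVec_mem_omegaCone (a := a) (S := {p | p.1 ≠ p.2}) hij)
      (PointedCone.smul_mem _ (sub_nonneg.2 hs) (he i)))
      (PointedCone.smul_mem _ (neg_le_iff_add_nonneg.1 ht) (he j))
    convert this using 1
    simp only [omegaVec]
    module

theorem omegaCone_ne_eq_hull_insert (hn : 2 ≤ n) {k : Fin n} (h : ∀ j, j ≠ k → a j = 0) :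
    omegaCone a {p | p.1 ≠ p.2} =
      PointedCone.hull ℝ (insert (stdVec k) ((fun i => omegaVec a i k) '' {i | i ≠ k})) := by
  refine le_antisymm (omegaCone_le fun i j hij => ?_) (Submodule.span_le.2 ?_)
  · have hω : ∀ i, i ≠ k → omegaVec a i k ∈
        PointedCone.hull ℝ (insert (stdVec k) ((fun i => omegaVec a i k) '' {i | i ≠ k})) :=
      fun i hi => Submodule.subset_span (Or.inr ⟨i, hi, rfl⟩)
    by_cases hj : j = k
    · subst hj
      exact hω i hij
    · refine omegaVec_mem_of_stdVec_mem ?_ (h j hj)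
      have hk : stdVec k ∈
          PointedCone.hull ℝ (insert (stdVec k) ((fun i => omegaVec a i k) '' {i | i ≠ k})) :=
        Submodule.subset_span (Or.inl rfl)
      by_cases hi : i = k
      · exact hi ▸ hk
      · exact stdVec_mem_of_omegaVec_mem (hω i hi) hk
  · rintro _ (rfl | ⟨i, hi, rfl⟩)
    · exact stdVec_mem_omegaCone_ne hn a k
    · exact omegaVec_mem_omegaCone hi

end omegaCone

/-- (a) `C_a` contains every standard basis vector `e_i`; consequently for all `i, j`
(possibly equal) and integers `p ≤ −a_i − 1`, `q ≥ −a_j`, the vector `−p·e_i + q·e_j`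
lies in `C_a`.
(b) If `a_i > 0` for at least two indices, then `C_a` equals the cone generated by the
`ω_{ij}` with `i ≠ j` and `a_j > 0`.
(c) If `a = g·e_{i₀}` (i.e. `a_{i₀} = g ≥ 1` and `a_j = 0` for `j ≠ i₀`),
then `C_a` equals the cone generated by `e_{i₀}` together with the `ω_{i i₀}`, `i ≠ i₀`. -/
theorem cone_Ca_generation (n : ℕ) (hn : 2 ≤ n) (a : Fin n → ℕ) :
    ((∀ i : Fin n, stdVec i ∈ coneCa a) ∧
      ∀ (i j : Fin n) (p q : ℤ), p ≤ -(a i : ℤ) - 1 → -(a j : ℤ) ≤ q →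
        (-(p : ℝ)) • stdVec i + (q : ℝ) • stdVec j ∈ coneCa a) ∧
    ((∃ i j : Fin n, i ≠ j ∧ 0 < a i ∧ 0 < a j) →
      coneCa a = {x | ∃ c : Fin n → Fin n → ℝ, (∀ i j, 0 ≤ c i j) ∧ (∀ i, c i i = 0) ∧
        (∀ i j, a j = 0 → c i j = 0) ∧ x = ∑ i, ∑ j, c i j • omegaVec a i j}) ∧
    (∀ (i₀ : Fin n) (g : ℕ), 1 ≤ g → a i₀ = g → (∀ j, j ≠ i₀ → a j = 0) →
      coneCa a = {x | ∃ (c₀ : ℝ) (c : Fin n → ℝ), 0 ≤ c₀ ∧ (∀ i, 0 ≤ c i) ∧ c i₀ = 0 ∧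
        x = c₀ • stdVec i₀ + ∑ i, c i • omegaVec a i i₀}) := by
  rw [coneCa_eq_omegaCone]
  refine ⟨⟨stdVec_mem_omegaCone_ne hn a, fun i j p q hp hq => ?_⟩, fun h => ?_,
    fun k g _ _ h => ?_⟩
  · have hp' : (p : ℝ) ≤ -(a i : ℝ) - 1 := by exact_mod_cast hp
    have hq' : -(a j : ℝ) ≤ q := by exact_mod_cast hq
    exact smul_stdVec_add_smul_stdVec_mem_omegaCone hn a i j (by linarith) hq'
  · rw [omegaCone_ne_eq_omegaCone_pos h]
    ext x
    rw [SetLike.mem_coe, mem_omegaCone_iff]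
    refine exists_congr fun c => and_congr_right fun _ => ?_
    rw [← and_assoc]
    refine and_congr_left fun _ => ⟨fun hc => ⟨fun i => hc i i (by simp),
      fun i j hj => hc i j (by simp [hj])⟩, fun hc i j hij => ?_⟩
    by_cases h' : i = j
    · exact h' ▸ hc.1 i
    · exact hc.2 i j (by simpa [h'] using hij)
  · rw [omegaCone_ne_eq_hull_insert hn h]
    ext x
    rw [SetLike.mem_coe, PointedCone.hull, Submodule.mem_span_insert]
    constructor
    · rintro ⟨r, z, hz, rfl⟩
      obtain ⟨c, hc, hck, rfl⟩ := (PointedCone.mem_hull_image_iff_exists_sum _ _ _).1 hz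
      exact ⟨r, c, r.2, hc, hck k (by simp), rfl⟩
    · rintro ⟨r, c, hr, hc, hck, rfl⟩
      refine ⟨⟨r, hr⟩, _, (PointedCone.mem_hull_image_iff_exists_sum _ _ _).2
        ⟨c, hc, fun i hi => ?_, rfl⟩, rfl⟩
      obtain rfl : i = k := by simpa using hi
      exact hck
end

section
/- For all indices i, j ∈ {1,…,n} (possibly equal) and all integers p ≤ −a_i − 1 and q ≥ −a_j, one has ℓ(−p·e_i + q·e_j) = (−p)·w_i + q·w_j ≥ 1/N. In particular, for i ≠ j one has ℓ(ω_{ij}) = (a_i+1)·w_i − a_j·w_j ≥ 1/N, where ω_{ij} = (a_i+1)·e_i − a_j·e_j; hence the set Ω_a of all weight vectors −p·e_i + q·e_j with p ≤ −a_i − 1 and q ≥ −a_j lies in the open half-space ℓ > 0. -/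
/-- The weight attached to an exponent `k ≤ N` satisfies `w > 0`, `k * w ≤ 1` and
`1 + 1 / N ≤ (k + 1) * w`. -/
lemma exponent_weight_bounds {k N : ℕ} (hN : 0 < N) (hk : k ≤ N) {w : ℝ}
    (hw : w = if k = 0 then 1 + 1 / (N : ℝ) else 1 / (k : ℝ)) :
    0 < w ∧ (k : ℝ) * w ≤ 1 ∧ 1 + 1 / (N : ℝ) ≤ ((k : ℝ) + 1) * w := by
  subst hw
  have hN' : (0 : ℝ) < N := by exact_mod_cast hN
  rcases Nat.eq_zero_or_pos k with rfl | hpos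
  · simp only [if_true, Nat.cast_zero, zero_mul, zero_add, one_mul]
    exact ⟨by positivity, zero_le_one, le_rfl⟩
  · have hk' : (0 : ℝ) < k := by exact_mod_cast hpos
    have hle : 1 / (N : ℝ) ≤ 1 / k := one_div_le_one_div_of_le hk' (by exact_mod_cast hk)
    have hmul : (k : ℝ) * (1 / k) = 1 := mul_one_div_cancel hk'.ne'
    rw [if_neg hpos.ne']
    exact ⟨by positivity, hmul.le, by linarith⟩

/-- Let `n ≥ 1`, `a = (a₁,…,aₙ) ∈ ℤ_{≥0}ⁿ` with `a ≠ 0`, and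
`N := max(a₁,…,aₙ)`. Define weights `w i := 1/a_i` if `a_i > 0` and `w i := 1 + 1/N`
if `a_i = 0`, and let `ℓ : ℝⁿ → ℝ` be the linear functional with `ℓ(e_i) = w_i`.
Then for all `i, j` (possibly equal) and all integers `p ≤ −a_i − 1`, `q ≥ −a_j`, one has
`ℓ(−p·e_i + q·e_j) = (−p)·w_i + q·w_j ≥ 1/N`; in particular, for `i ≠ j`,
`ℓ(ω_{ij}) = (a_i+1)·w_i − a_j·w_j ≥ 1/N`; hence all the weight vectors
`−p·e_i + q·e_j` lie in the open half-space `ℓ > 0`. -/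
theorem weights_in_positive_halfspace (n : ℕ) (hn : 1 ≤ n) (a : Fin n → ℕ)
    (ha : a ≠ 0) (N : ℕ) (hN : N = Finset.univ.sup a)
    (w : Fin n → ℝ)
    (hw : ∀ i, w i = if a i = 0 then 1 + 1 / (N : ℝ) else 1 / (a i : ℝ)) :
    (∀ (i j : Fin n) (p q : ℤ), p ≤ -(a i : ℤ) - 1 → -(a j : ℤ) ≤ q →
      (1 : ℝ) / N ≤ (-(p : ℝ)) * w i + (q : ℝ) * w j) ∧
    (∀ i j : Fin n, i ≠ j →
      (1 : ℝ) / N ≤ ((a i : ℝ) + 1) * w i - (a j : ℝ) * w j) ∧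
    (∀ (i j : Fin n) (p q : ℤ), p ≤ -(a i : ℤ) - 1 → -(a j : ℤ) ≤ q →
      0 < (-(p : ℝ)) * w i + (q : ℝ) * w j) := by
  have hle : ∀ i, a i ≤ N := fun i => hN ▸ Finset.le_sup (Finset.mem_univ i)
  obtain ⟨k, hk⟩ := Function.ne_iff.mp ha
  have hNpos : 0 < N := (Nat.pos_of_ne_zero hk).trans_le (hle k)
  have hbound := fun i => exponent_weight_bounds hNpos (hle i) (hw i)
  have hmain : ∀ (i j : Fin n) (p q : ℤ), p ≤ -(a i : ℤ) - 1 → -(a j : ℤ) ≤ q →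
      (1 : ℝ) / N ≤ (-(p : ℝ)) * w i + (q : ℝ) * w j := by
    intro i j p q hp hq
    obtain ⟨hi, -, hi'⟩ := hbound i
    obtain ⟨hj, hj', -⟩ := hbound j
    have hp' : (a i : ℝ) + 1 ≤ -(p : ℝ) := by
      have : (p : ℝ) ≤ -(a i : ℝ) - 1 := by exact_mod_cast hp
      linarith
    have hq' : -(a j : ℝ) ≤ q := by exact_mod_cast hq
    have h₁ := mul_le_mul_of_nonneg_right hp' hi.le
    have h₂ := mul_le_mul_of_nonneg_right hq' hj.le
    linarith
  refine ⟨hmain, fun i j _ => ?_, fun i j p q hp hq => ?_⟩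
  · linarith [(hbound i).2.2, (hbound j).2.1]
  · exact (one_div_pos.mpr (Nat.cast_pos.mpr hNpos)).trans_le (hmain i j p q hp hq)
end

section
/- Let n ≥ 2 and let a, a' ∈ ℤ_{≥0}ⁿ satisfy Σ_{i=1}^n a_i = Σ_{i=1}^n a'_i = g ≥ 1. Then χ_{a,a'} ∈ C_a. -/
/-- The set `coneCa a` as a pointed cone. -/
noncomputable def pointedConeCa {n : ℕ} (a : Fin n → ℕ) : PointedCone ℝ (Fin n → ℝ) where
  carrier := coneCa a
  zero_mem' := ⟨0, by simp, by simp, by simp⟩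
  add_mem' := by
    rintro _ _ ⟨c, hc, hc', rfl⟩ ⟨d, hd, hd', rfl⟩
    refine ⟨c + d, fun i j => add_nonneg (hc i j) (hd i j), fun i => by simp [hc', hd'], ?_⟩
    simp [add_smul, Finset.sum_add_distrib]
  smul_mem' := by
    rintro ⟨r, hr⟩ _ ⟨c, hc, hc', rfl⟩
    refine ⟨r • c, fun i j => mul_nonneg hr (hc i j), fun i => by simp [hc'], ?_⟩
    simp [Finset.smul_sum, mul_smul, Nonneg.mk_smul]

lemma smul_mem_pointedConeCa {n : ℕ} {a : Fin n → ℕ} {r : ℝ} (hr : 0 ≤ r) {x : Fin n → ℝ}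
    (hx : x ∈ pointedConeCa a) : r • x ∈ pointedConeCa a :=
  (pointedConeCa a).smul_mem hr hx

lemma omegaVec_mem_of_ne {n : ℕ} (a : Fin n → ℕ) {i j : Fin n} (hij : i ≠ j) :
    omegaVec a i j ∈ pointedConeCa a := by
  refine ⟨fun k l => if k = i ∧ l = j then 1 else 0, fun k l => by positivity, ?_, ?_⟩
  · rintro k
    exact if_neg fun h => hij (h.1.symm.trans h.2)
  · simp [ite_and, ite_smul]

/-- Every standard basis vector lies in the cone, being proportional to
`(a_j + 1) ω_{ij} + a_j ω_{ji}` for any `j ≠ i`. -/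
lemma stdVec_mem_pointedConeCa {n : ℕ} (hn : 2 ≤ n) (a : Fin n → ℕ) (i : Fin n) :
    stdVec i ∈ pointedConeCa a := by
  have : Nontrivial (Fin n) := Fin.nontrivial_iff_two_le.mpr hn
  obtain ⟨j, hj⟩ := exists_ne i
  have key : stdVec i = ((a i : ℝ) + a j + 1)⁻¹ •
      (((a j : ℝ) + 1) • omegaVec a i j + (a j : ℝ) • omegaVec a j i) := by
    have h : ((a i : ℝ) + a j + 1) ≠ 0 := by positivity
    rw [eq_inv_smul_iff₀ h]
    unfold omegaVec
    module
  rw [key]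
  exact smul_mem_pointedConeCa (by positivity) (add_mem
    (smul_mem_pointedConeCa (by positivity) (omegaVec_mem_of_ne a hj.symm))
    (smul_mem_pointedConeCa (by positivity) (omegaVec_mem_of_ne a hj)))

lemma omegaVec_mem_pointedConeCa {n : ℕ} (hn : 2 ≤ n) (a : Fin n → ℕ) (i j : Fin n) :
    omegaVec a i j ∈ pointedConeCa a := by
  obtain rfl | hij := eq_or_ne i j
  · have : omegaVec a i i = stdVec i := by
      unfold omegaVec
      module
    exact this ▸ stdVec_mem_pointedConeCa hn a i
  · exact omegaVec_mem_of_ne a hij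

/-- Nonnegative row sums `R` and column sums `S` with equal totals are realised by a nonnegative
matrix, so the corresponding combination of the `ω_{ij}` lies in the cone. -/
lemma sum_smul_stdVec_mem_pointedConeCa {n : ℕ} (hn : 2 ≤ n) (a : Fin n → ℕ) (R S : Fin n → ℝ)
    (hR : ∀ i, 0 ≤ R i) (hS : ∀ i, 0 ≤ S i) (hRS : ∑ i, R i = ∑ i, S i) :
    ∑ i, ((a i + 1) * R i - a i * S i) • stdVec i ∈ pointedConeCa a := by
  have hT : 0 ≤ ∑ i, S i := Finset.sum_nonneg fun i _ => hS i
  obtain h0 | h0 := hT.eq_or_lt'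
  · have hS0 : ∀ i, S i = 0 := by
      simpa using (Finset.sum_eq_zero_iff_of_nonneg fun i _ => hS i).mp h0
    have hR0 : ∀ i, R i = 0 := by
      simpa using (Finset.sum_eq_zero_iff_of_nonneg fun i _ => hR i).mp (hRS.trans h0)
    simp [hS0, hR0]
  · have key : ∑ i, ((a i + 1) * R i - a i * S i) • stdVec i =
        (∑ i, S i)⁻¹ • ∑ i, ∑ j, (R i * S j) • omegaVec a i j := by
      rw [eq_inv_smul_iff₀ h0.ne']
      simp only [omegaVec, smul_sub, sub_smul, Finset.sum_sub_distrib, smul_smul]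
      congr 1
      · rw [Finset.smul_sum]
        refine Finset.sum_congr rfl fun i _ => ?_
        rw [← Finset.sum_smul, ← Finset.sum_mul, ← Finset.mul_sum, smul_smul]
        congr 1
        ring
      · rw [Finset.sum_comm, Finset.smul_sum]
        refine Finset.sum_congr rfl fun i _ => ?_
        rw [← Finset.sum_smul, ← Finset.sum_mul, ← Finset.sum_mul, smul_smul, hRS]
        congr 1
        ring
    rw [key]
    exact smul_mem_pointedConeCa (inv_nonneg.mpr hT) (sum_mem fun i _ => sum_mem fun j _ =>
      smul_mem_pointedConeCa (mul_nonneg (hR i) (hS j)) (omegaVec_mem_pointedConeCa hn a i j))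

lemma mul_add_one_nonneg_of_int (d : ℤ) : 0 ≤ d * (d + 1) := by
  obtain h | h := le_or_gt 0 d
  · positivity
  · exact mul_nonneg_of_nonpos_of_nonpos h.le (by lia)

/-- Let `n ≥ 2` and `a, a' ∈ ℤ_{≥0}ⁿ` with
`Σ a_i = Σ a'_i = g ≥ 1`. Then
`χ_{a,a'} := Σ_i (C(a'_i+1,2) − C(a_i+1,2))·e_i` lies in `C_a`. -/
theorem chi_mem_coneCa (n : ℕ) (hn : 2 ≤ n) (a a' : Fin n → ℕ) (g : ℕ) (hg : 1 ≤ g)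
    (hsum : ∑ i, a i = g) (hsum' : ∑ i, a' i = g) :
    (∑ i, (((Nat.choose (a' i + 1) 2 : ℝ)) - (Nat.choose (a i + 1) 2 : ℝ)) • stdVec i)
      ∈ coneCa a := by
  have hRnn (d : ℤ) : (0 : ℝ) ≤ d * (d + 1) / 2 :=
    div_nonneg (mod_cast mul_add_one_nonneg_of_int d) zero_le_two
  let d : Fin n → ℤ := fun i => a' i - a i
  have hd : ∑ i, (d i : ℝ) = 0 := by
    have h : (∑ i, (a i : ℝ)) = ∑ i, (a' i : ℝ) := mod_cast hsum.trans hsum'.symm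
    simp [d, h]
  have key := sum_smul_stdVec_mem_pointedConeCa hn a (fun i => d i * (d i + 1) / 2)
    (fun i => d i * (d i - 1) / 2) (fun i => hRnn (d i))
    (fun i => by
      have := hRnn (d i - 1)
      push_cast at this
      linarith)
    (by
      rw [← sub_eq_zero, ← Finset.sum_sub_distrib, ← hd]
      exact Finset.sum_congr rfl fun i _ => by ring)
  change _ ∈ pointedConeCa a
  convert key using 3 with i
  simp only [Nat.cast_choose_two, d]
  push_cast
  ring
end

section
/- Let x ∈ H and m₀ ∈ ℤ, and suppose that for every integer m > m₀ there exists s ∈ H with invertible leading terms of order m such that every component of the product x·s lies in t^{−m₀}·R[[t]]. Then x = 0. In particular, any element of H with invertible leading terms of some order is a non-zero-divisor in H. -/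
/-- If `x` vanishes below `a` and `y` vanishes below `b`, then the coefficient of `x * y` at
`a + b` is the product of the coefficients of `x` at `a` and `y` at `b`. -/
theorem HahnSeries.coeff_mul_add_of_forall_lt {Γ R : Type*} [AddCommMonoid Γ] [LinearOrder Γ]
    [IsOrderedCancelAddMonoid Γ] [NonUnitalNonAssocSemiring R] {x y : HahnSeries Γ R} {a b : Γ}
    (hx : ∀ l < a, x.coeff l = 0) (hy : ∀ l < b, y.coeff l = 0) :
    (x * y).coeff (a + b) = x.coeff a * y.coeff b := by
  rw [HahnSeries.coeff_mul, Finset.sum_eq_single (a, b)]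
  · rintro ⟨i, j⟩ hij hne
    rw [Finset.mem_antidiagonal] at hij
    obtain ⟨-, -, hsum⟩ := hij
    rcases lt_trichotomy i a with hi | rfl | hi
    · simp [hx i hi]
    · exact absurd (congrArg (Prod.mk i) (add_left_cancel hsum)) hne
    · have hj : j < b := by
        by_contra! hj
        exact (add_lt_add_of_lt_of_le hi hj).ne' hsum
      simp [hy j hj]
  · intro h
    by_contra hne
    exact h (Finset.mem_antidiagonal.2
      ⟨left_ne_zero_of_mul hne, right_ne_zero_of_mul hne, rfl⟩)

/-- Multiplying a nonzero Laurent series by one whose lowest coefficient is a unit gives a series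
with nonzero coefficient at the sum of the orders. -/
theorem LaurentSeries.coeff_mul_order_add_ne_zero {R : Type*} [CommRing R]
    {x s : LaurentSeries R} {b : ℤ} (hx : x ≠ 0) (hs : ∀ l < b, s.coeff l = 0)
    (hu : IsUnit (s.coeff b)) : (x * s).coeff (x.order + b) ≠ 0 := by
  rw [HahnSeries.coeff_mul_add_of_forall_lt
    (fun _ hl => HahnSeries.coeff_eq_zero_of_lt_order hl) hs, Ne, hu.mul_left_eq_zero]
  exact HahnSeries.coeff_order_eq_zero.not.2 hx


/-- An element `s` of `H = ∏_{i=1}^n R((t))` has *invertible leading terms of order `m`*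
if each component `s_i` lies in `t^{−m}·R[[t]]` and the coefficient of `t^{−m}` in `s_i`
is a unit of `R`. -/
def HasInvLeadingTerms {R : Type*} [CommRing R] {n : ℕ}
    (s : Fin n → LaurentSeries R) (m : ℤ) : Prop :=
  ∀ i : Fin n, (∀ l : ℤ, l < -m → (s i).coeff l = 0) ∧ IsUnit ((s i).coeff (-m))

/-- Let `R` be a commutative ring, `n ≥ 1`, and
`H = ∏_{i=1}^n R((t_i))`.  If `x ∈ H` and `m₀ ∈ ℤ` are such that for every `m > m₀`
there is `s ∈ H` with invertible leading terms of order `m` such that every component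
of `x·s` lies in `t^{−m₀}·R[[t]]`, then `x = 0`.  In particular, any element of `H`
with invertible leading terms of some order is a non-zero-divisor in `H`. -/
theorem eq_zero_of_mul_leading_bounded {R : Type*} [CommRing R] {n : ℕ} (hn : 1 ≤ n) :
    (∀ (x : Fin n → LaurentSeries R) (m₀ : ℤ),
      (∀ m : ℤ, m₀ < m → ∃ s : Fin n → LaurentSeries R, HasInvLeadingTerms s m ∧
        ∀ i : Fin n, ∀ l : ℤ, l < -m₀ → ((x * s) i).coeff l = 0) →
      x = 0) ∧
    (∀ (s : Fin n → LaurentSeries R) (m : ℤ), HasInvLeadingTerms s m →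
      ∀ y : Fin n → LaurentSeries R, y * s = 0 → y = 0) := by
  refine ⟨fun x m₀ h => ?_, fun s m hs y hys => ?_⟩
  · funext i
    by_contra hx
    obtain ⟨s, hs, hxs⟩ := h (max m₀ (m₀ + (x i).order) + 1) (by omega)
    exact LaurentSeries.coeff_mul_order_add_ne_zero hx (hs i).1 (hs i).2 (hxs i _ (by omega))
  · funext i
    by_contra hy
    refine LaurentSeries.coeff_mul_order_add_ne_zero hy (hs i).1 (hs i).2 ?_
    rw [← Pi.mul_apply, hys, Pi.zero_apply, HahnSeries.coeff_zero]
end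

section
/- Let B be a commutative ℚ-algebra, z ∈ B a non-zero-divisor, and A = B[1/z] the localization, so that z^{−j}·B makes sense as a B-submodule of A for j ≥ 0. Let c₁, c₂, … ∈ A and set u := t + Σ_{l ≥ 1} c_l·t^{l+1} ∈ A[[t]], a power series invertible in the ring of Laurent series A((t)). Fix integers m ≥ 0 and N ≥ 1, and assume that for each j = 1,…,N the coefficients of t^{−m−j}, t^{−m−j+1}, …, t^{−m} in the Laurent series u^{−m−j} ∈ A((t)) all lie in z^{−j}·B. Then c_l ∈ z^{−l}·B for every l = 1,…,N; consequently, for every integer a, the coefficients of t^a, t^{a+1}, …, t^{a+N} in the Laurent series u^a all lie in z^{−N}·B. -/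
/-- For `A = B[1/z]`, membership `x ∈ z^{−j}·B`, viewed inside `A`. -/
def MemZPowInv {B : Type*} [CommRing B] (z : B) (j : ℕ)
    (x : Localization.Away z) : Prop :=
  ∃ b : B, (algebraMap B (Localization.Away z) z) ^ j * x =
    algebraMap B (Localization.Away z) b

namespace PowerSeries

variable {A : Type*} [CommRing A] (M : ℕ → AddSubgroup A) [SetLike.GradedMonoid M]

/-- If the coefficients of two power series with constant term `1` respect a multiplicative
filtration below degree `n`, then modulo the filtration the `n`-th coefficient is additive
on their product. -/
theorem coeff_mul_sub_sub_mem {n : ℕ} (hn : n ≠ 0) {f g : PowerSeries A}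
    (hf0 : coeff 0 f = 1) (hg0 : coeff 0 g = 1)
    (hf : ∀ k < n, coeff k f ∈ M k) (hg : ∀ k < n, coeff k g ∈ M k) :
    coeff n (f * g) - coeff n f - coeff n g ∈ M n := by
  obtain ⟨k, rfl⟩ := Nat.exists_eq_succ_of_ne_zero hn
  rw [coeff_mul, Finset.Nat.sum_antidiagonal_eq_sum_range_succ_mk, Finset.sum_range_succ,
    Finset.sum_range_succ']
  simp only [Nat.succ_eq_add_one, Nat.sub_self, Nat.sub_zero, hf0, hg0, one_mul, mul_one]
  rw [add_sub_cancel_right, add_sub_cancel_right]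
  refine sum_mem fun i hi => ?_
  have hik : i < k := Finset.mem_range.mp hi
  have h := SetLike.mul_mem_graded (hf (i + 1) (by omega)) (hg (k + 1 - (i + 1)) (by omega))
  rwa [show i + 1 + (k + 1 - (i + 1)) = k + 1 by omega] at h

/-- The invertible power series with constant term `1` whose coefficients of degree `k < n`
lie in `M k`. -/
def filteredUnits (n : ℕ) : Subgroup (PowerSeries A)ˣ where
  carrier := {f | coeff 0 (f : PowerSeries A) = 1 ∧ ∀ k < n, coeff k (f : PowerSeries A) ∈ M k}
  one_mem' := by
    refine ⟨by simp, fun k _ => ?_⟩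
    rw [Units.val_one, coeff_one]
    split_ifs with h
    · exact h ▸ SetLike.one_mem_graded M
    · exact zero_mem _
  mul_mem' := by
    rintro f g ⟨hf0, hf⟩ ⟨hg0, hg⟩
    refine ⟨by simp [coeff_mul, hf0, hg0, -coeff_zero_eq_constantCoeff], fun k hk => ?_⟩
    rw [Units.val_mul, coeff_mul]
    refine sum_mem fun p hp => ?_
    have hp := Finset.HasAntidiagonal.mem_antidiagonal.mp hp
    exact hp ▸ SetLike.mul_mem_graded (hf p.1 (by omega)) (hg p.2 (by omega))
  inv_mem' := by
    rintro f ⟨hf0, hf⟩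
    have hinv : (f : PowerSeries A) * (f⁻¹ : (PowerSeries A)ˣ) = 1 := f.mul_inv
    have hg0 : coeff 0 ((f⁻¹ : (PowerSeries A)ˣ) : PowerSeries A) = 1 := by
      have h := congrArg (coeff 0) hinv
      simpa [-Units.mul_inv, coeff_mul, hf0, -coeff_zero_eq_constantCoeff] using h
    refine ⟨hg0, fun k => ?_⟩
    induction k using Nat.strong_induction_on with
    | _ k ih =>
      intro hk
      rcases eq_or_ne k 0 with rfl | hk0
      · exact hg0 ▸ SetLike.one_mem_graded M
      have h := coeff_mul_sub_sub_mem M hk0 hf0 hg0 (fun i hi => hf i (hi.trans hk))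
        fun i hi => ih i hi (hi.trans hk)
      rw [hinv, coeff_one, if_neg hk0, zero_sub] at h
      simpa using add_mem (neg_mem h) (neg_mem (hf k hk))

variable {M}

/-- Modulo the filtration, the `n`-th coefficient of `w ^ a` is `a` times that of `w`. -/
theorem coeff_zpow_sub_zsmul_mem {n : ℕ} (hn : n ≠ 0) {w : (PowerSeries A)ˣ}
    (hw : w ∈ filteredUnits M n) (a : ℤ) :
    coeff n ((w ^ a : (PowerSeries A)ˣ) : PowerSeries A) - a • coeff n (w : PowerSeries A)
      ∈ M n := by
  have step (b : ℤ) :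
      coeff n ((w ^ (b + 1) : (PowerSeries A)ˣ) : PowerSeries A) -
        coeff n ((w ^ b : (PowerSeries A)ˣ) : PowerSeries A) - coeff n (w : PowerSeries A)
          ∈ M n := by
    have hb := zpow_mem hw b
    rw [zpow_add_one, Units.val_mul]
    exact coeff_mul_sub_sub_mem M hn hb.1 hw.1 hb.2 hw.2
  induction a using Int.induction_on with
  | zero => simp [coeff_one, hn]
  | succ i ih =>
    convert add_mem ih (step i) using 1
    rw [add_smul, one_smul]; ring
  | pred i ih =>
    convert sub_mem ih (step (-i - 1)) using 1
    rw [sub_smul, one_smul, sub_add_cancel]; ring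

/-- If `n`-th coefficients of suitable powers respect the filtration, so do the coefficients
of the power series itself. -/
theorem mem_filteredUnits_of_coeff_zpow_mem {N : ℕ} {w : (PowerSeries A)ˣ}
    (hw0 : coeff 0 (w : PowerSeries A) = 1) (e : ℕ → ℤ)
    (hdiv : ∀ n, n ≠ 0 → ∀ x, e n • x ∈ M n → x ∈ M n)
    (he : ∀ n, n ≠ 0 → n ≤ N → coeff n ((w ^ e n : (PowerSeries A)ˣ) : PowerSeries A) ∈ M n) :
    w ∈ filteredUnits M (N + 1) := by
  refine ⟨hw0, fun n => ?_⟩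
  induction n using Nat.strong_induction_on with
  | _ n ih =>
    intro hn
    rcases eq_or_ne n 0 with rfl | hn0
    · exact hw0 ▸ SetLike.one_mem_graded M
    have hw : w ∈ filteredUnits M n := ⟨hw0, fun k hk => ih k hk (hk.trans hn)⟩
    refine hdiv n hn0 _ ?_
    simpa using sub_mem (he n hn0 (by omega)) (coeff_zpow_sub_zsmul_mem hn0 hw (e n))

end PowerSeries

namespace LaurentSeries

/-- If `U = t * w` with `w` an invertible power series, then the coefficient of `t ^ (a + k)`
in `U ^ a` is the `k`-th coefficient of `w ^ a`. -/
theorem coeff_zpow_add_of_eq_X_mul {A : Type*} [CommRing A] (U : (LaurentSeries A)ˣ)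
    (w : (PowerSeries A)ˣ)
    (hU : (U : LaurentSeries A) =
      HahnSeries.ofPowerSeries ℤ A (PowerSeries.X * (w : PowerSeries A)))
    (a : ℤ) (k : ℕ) :
    ((U ^ a : (LaurentSeries A)ˣ) : LaurentSeries A).coeff (a + k) =
      PowerSeries.coeff k ((w ^ a : (PowerSeries A)ˣ) : PowerSeries A) := by
  let φ : Multiplicative ℤ →* LaurentSeries A :=
    { toFun := fun n => HahnSeries.single n.toAdd 1
      map_one' := rfl
      map_mul' := fun x y => by rw [HahnSeries.single_mul_single, mul_one, toAdd_mul] }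
  have hφ (n : ℤ) : ((φ.toHomUnits (Multiplicative.ofAdd n) : (LaurentSeries A)ˣ) :
      LaurentSeries A) = HahnSeries.single n 1 := rfl
  have key : U = φ.toHomUnits (Multiplicative.ofAdd 1) *
      Units.map (HahnSeries.ofPowerSeries ℤ A : PowerSeries A →* LaurentSeries A) w := by
    ext1
    rw [hU, map_mul, HahnSeries.ofPowerSeries_X, Units.val_mul, hφ]
    rfl
  rw [key, mul_zpow, ← MonoidHom.map_zpow, ← MonoidHom.map_zpow, ← ofAdd_zsmul, smul_eq_mul, mul_one,
    Units.val_mul, hφ, HahnSeries.coeff_single_mul, one_mul, add_sub_cancel_left]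
  exact HahnSeries.ofPowerSeries_apply_coeff _ k

end LaurentSeries

namespace MemZPowInv

variable {B : Type*} [CommRing B] (z : B)

/-- The additive subgroup `z^{−j}·B` of `B[1/z]`. -/
def addSubgroup (j : ℕ) : AddSubgroup (Localization.Away z) where
  carrier := {x | MemZPowInv z j x}
  zero_mem' := ⟨0, by simp⟩
  add_mem' := by
    rintro x y ⟨b, hb⟩ ⟨d, hd⟩
    exact ⟨b + d, by rw [mul_add, hb, hd, map_add]⟩
  neg_mem' := by
    rintro x ⟨b, hb⟩
    exact ⟨-b, by rw [mul_neg, hb, map_neg]⟩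

instance : SetLike.GradedMonoid (addSubgroup z) where
  one_mem := ⟨1, by simp⟩
  mul_mem := by
    rintro i j x y ⟨b, hb⟩ ⟨d, hd⟩
    exact ⟨b * d, by rw [map_mul, ← hb, ← hd]; ring⟩

variable {z}

theorem mono {i j : ℕ} (hij : i ≤ j) {x : Localization.Away z} (hx : MemZPowInv z i x) :
    MemZPowInv z j x := by
  obtain ⟨k, rfl⟩ := Nat.exists_eq_add_of_le hij
  obtain ⟨b, hb⟩ := hx
  exact ⟨z ^ k * b, by rw [map_mul, map_pow, ← hb]; ring⟩

theorem of_zsmul [Algebra ℚ B] {j : ℕ} {e : ℤ} (he : e ≠ 0) {x : Localization.Away z}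
    (hx : MemZPowInv z j (e • x)) : MemZPowInv z j x := by
  obtain ⟨b, hb⟩ := hx
  have h : algebraMap ℚ B (e : ℚ)⁻¹ * (e : B) = 1 := by
    rw [← map_intCast (algebraMap ℚ B) e, ← map_mul,
      inv_mul_cancel₀ (Int.cast_ne_zero.mpr he), map_one]
  have h' := congrArg (algebraMap B (Localization.Away z)) h
  rw [map_mul, map_intCast, map_one] at h'
  refine ⟨algebraMap ℚ B (e : ℚ)⁻¹ * b, ?_⟩
  rw [map_mul, ← hb, zsmul_eq_mul]
  linear_combination -(algebraMap B (Localization.Away z) z ^ j * x) * h'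

end MemZPowInv

/-- Let `B` be a commutative `ℚ`-algebra, `z ∈ B` a non-zero-divisor,
`A = B[1/z]`, and `u = t + Σ_{l ≥ 1} c_l t^{l+1} ∈ A[[t]]`, invertible in `A((t))`
(with inverse packaged in the unit `U`). Fix `m ≥ 0` and `N ≥ 1`, and assume that for
each `j = 1,…,N` the coefficients of `t^{−m−j},…,t^{−m}` in `u^{−m−j}` all lie in
`z^{−j}·B`. Then `c_l ∈ z^{−l}·B` for `l = 1,…,N`; consequently, for every integer `a`
the coefficients of `t^a,…,t^{a+N}` in `u^a` all lie in `z^{−N}·B`. -/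
theorem coeff_pole_bound_of_canonical_parameter
    {B : Type*} [CommRing B] [Algebra ℚ B] (z : B) (hz : z ∈ nonZeroDivisors B)
    (c : ℕ → Localization.Away z)
    (u : PowerSeries (Localization.Away z))
    (hu : u = PowerSeries.mk fun k =>
      if k = 1 then 1 else if 2 ≤ k then c (k - 1) else 0)
    (U : (LaurentSeries (Localization.Away z))ˣ)
    (hU : (U : LaurentSeries (Localization.Away z)) =
      HahnSeries.ofPowerSeries ℤ (Localization.Away z) u)
    (m N : ℕ) (hN : 1 ≤ N)
    (hyp : ∀ j : ℕ, 1 ≤ j → j ≤ N → ∀ l : ℤ, -(m : ℤ) - j ≤ l → l ≤ -(m : ℤ) →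
      MemZPowInv z j
        (((U ^ (-(m : ℤ) - j) : (LaurentSeries (Localization.Away z))ˣ) :
          LaurentSeries (Localization.Away z)).coeff l)) :
    (∀ l : ℕ, 1 ≤ l → l ≤ N → MemZPowInv z l (c l)) ∧
    (∀ a : ℤ, ∀ l : ℤ, a ≤ l → l ≤ a + N →
      MemZPowInv z N
        (((U ^ a : (LaurentSeries (Localization.Away z))ˣ) :
          LaurentSeries (Localization.Away z)).coeff l)) := by
  let w₀ : PowerSeries (Localization.Away z) := PowerSeries.mk fun k => if k = 0 then 1 else c k
  have hw₀ : IsUnit w₀ := by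
    rw [PowerSeries.isUnit_iff_constantCoeff]
    simp [w₀, ← PowerSeries.coeff_zero_eq_constantCoeff_apply]
  obtain ⟨w, hw⟩ := hw₀
  have hwc (k : ℕ) (hk : k ≠ 0) :
      PowerSeries.coeff k (w : PowerSeries (Localization.Away z)) = c k := by
    simp [hw, w₀, hk]
  have hXw : u = PowerSeries.X * (w : PowerSeries (Localization.Away z)) := by
    rw [hu, hw]
    ext k
    rcases k with _ | _ | k
    · simp
    · simp [w₀]
    · simp [w₀, PowerSeries.coeff_succ_X_mul]
  rw [hXw] at hU
  have hcoeff := LaurentSeries.coeff_zpow_add_of_eq_X_mul U w hU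
  have hmem : w ∈ PowerSeries.filteredUnits (MemZPowInv.addSubgroup z) (N + 1) := by
    refine PowerSeries.mem_filteredUnits_of_coeff_zpow_mem (by simp [hw, w₀])
      (fun n => -(m : ℤ) - n)
      (fun n hn x hx => MemZPowInv.of_zsmul (by omega) hx) fun n hn hnN => ?_
    rw [← hcoeff]
    exact hyp n (by omega) hnN _ (by omega) (by omega)
  refine ⟨fun l hl hlN => ?_, fun a l hal hlN => ?_⟩
  · rw [← hwc l (by omega)]
    exact hmem.2 l (by omega)
  · obtain ⟨k, rfl⟩ := Int.le.dest hal
    rw [hcoeff]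
    exact MemZPowInv.mono (by omega) ((zpow_mem hmem a).2 k (by omega))
end
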